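/- For every q ∈ [2, 8] and every b > 2(q − 2)/(3q) there exists a constant C > 0, depending only on ν, μ, q and b, such that for every Schwartz function F on ℝ² one has ‖F‖_{L^q_{xt}(ℝ²)} ≤ C ‖F‖_{X_{0,b}}. (Space-time L^q embedding of Bourgain spaces, Lemma 2.4.) -/

import Mathlib

open MeasureTheory Real
open scoped ENNReal NNReal Classical

noncomputable section

/-- Phase function of the linear Benjamin equation: `φ(ξ) = -ν ξ|ξ| + μ ξ³`. -/
def phase (ν μ ξ : ℝ) : ℝ := -ν * ξ * |ξ| + μ * ξ ^ 3

/-- Derivative of the phase: `φ'(ξ) = -2ν|ξ| + 3μξ²`. -/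
def dphase (ν μ ξ : ℝ) : ℝ := -2 * ν * |ξ| + 3 * μ * ξ ^ 2

/-- The frequency threshold `a = 2·max(1, |2ν/(3μ)|)`. -/
def aconst (ν μ : ℝ) : ℝ := 2 * max 1 |2 * ν / (3 * μ)|

/-- Fourier transform in the space variable. -/
def FT (f : ℝ → ℂ) (ξ : ℝ) : ℂ := ∫ x : ℝ, Complex.exp (-(Complex.I * ξ * x)) * f x

/-- Space-time Fourier transform. -/
def FT2 (u : ℝ → ℝ → ℂ) (ξ τ : ℝ) : ℂ :=
  ∫ x : ℝ, ∫ t : ℝ, Complex.exp (-(Complex.I * (ξ * x + τ * t))) * u x t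

/-- Mixed norm `‖f‖_{L^p_x L^q_t}` (with exponents in `ℝ≥0∞`). -/
def mixedLpLq (p q : ℝ≥0∞) (f : ℝ → ℝ → ℂ) : ℝ≥0∞ :=
  if p = ∞ then essSup (fun x => eLpNorm (f x) q volume) volume
  else (∫⁻ x : ℝ, eLpNorm (f x) q volume ^ p.toReal) ^ (1 / p.toReal)

/-- The Bourgain norm `‖u‖_{X_{s,b}}` associated to the Benjamin phase function. -/
def XNorm (ν μ s b : ℝ) (u : ℝ → ℝ → ℂ) : ℝ≥0∞ :=
  (∫⁻ ξ : ℝ, ∫⁻ τ : ℝ,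
      ENNReal.ofReal ((1 + ξ ^ 2) ^ s * (1 + (τ - phase ν μ ξ) ^ 2) ^ b) *
        (‖FT2 u ξ τ‖₊ : ℝ≥0∞) ^ 2) ^ (1 / 2 : ℝ)

/-- The free Benjamin group `S(t)` applied to initial data `u₀`, as a function of `(x,t)`. -/
def Sgrp (ν μ : ℝ) (u₀ : ℝ → ℂ) (x t : ℝ) : ℂ :=
  (2 * π)⁻¹ • ∫ ξ : ℝ, Complex.exp (Complex.I * (ξ * x + phase ν μ ξ * t)) * FT u₀ ξ

/-- `D_x^α S(t) P^a u₀` : the Benjamin group composed with the Fourier restriction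
`P^a` to `{|ξ| ≥ a}` and the derivative operator `D_x^α`. -/
def DSgrpPa (ν μ α : ℝ) (u₀ : ℝ → ℂ) (x t : ℝ) : ℂ :=
  (2 * π)⁻¹ • ∫ ξ : ℝ,
    if aconst ν μ ≤ |ξ| then
      (↑(|ξ| ^ α) : ℂ) * Complex.exp (Complex.I * (ξ * x + phase ν μ ξ * t)) * FT u₀ ξ
    else 0

/-- `D_x^α P^a F` acting in the space variable of a space-time function `F`. -/
def DPa (ν μ α : ℝ) (F : ℝ → ℝ → ℂ) (x t : ℝ) : ℂ :=
  (2 * π)⁻¹ • ∫ ξ : ℝ,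
    if aconst ν μ ≤ |ξ| then
      (↑(|ξ| ^ α) : ℂ) * Complex.exp (Complex.I * (ξ * x)) * FT (fun y => F y t) ξ
    else 0

open scoped ComplexConjugate

/-- First-derivative van der Corput estimate. -/
lemma vdc_first {P P' P'' : ℝ → ℝ} (h1 : ∀ x, HasDerivAt P (P' x) x)
    (h2 : ∀ x, HasDerivAt P' (P'' x) x) (hc : Continuous P'') {a b l : ℝ} (hab : a ≤ b)
    (hl : 0 < l) (hP' : ∀ x ∈ Set.Icc a b, l ≤ |P' x|) (hP'' : ∀ x ∈ Set.Icc a b, 0 ≤ P'' x) :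
    ‖∫ x in a..b, Complex.exp (Complex.I * P x)‖ ≤ 4 / l := by
  have hP'c : Continuous P' := continuous_iff_continuousAt.2 fun x => (h2 x).continuousAt
  have hPc : Continuous P := continuous_iff_continuousAt.2 fun x => (h1 x).continuousAt
  have hne : ∀ x ∈ Set.Icc a b, P' x ≠ 0 := fun x hx h0 => by
    have := hP' x hx
    rw [h0, abs_zero] at this
    linarith
  have hinv : ∀ x ∈ Set.Icc a b, |(P' x)⁻¹| ≤ 1 / l := fun x hx => by
    rw [abs_inv, one_div]
    exact inv_anti₀ hl (hP' x hx)
  have hd : ∀ x ∈ Set.Icc a b, HasDerivAt (fun y => (P' y)⁻¹) (-P'' x / P' x ^ 2) x :=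
    fun x hx => (h2 x).inv (hne x hx)
  have hcont : ContinuousOn (fun x => -P'' x / P' x ^ 2) (Set.Icc a b) :=
    (hc.neg.continuousOn).div (hP'c.pow 2).continuousOn fun x hx => pow_ne_zero 2 (hne x hx)
  have hE : ∀ x, HasDerivAt (fun y => Complex.exp (Complex.I * P y))
      (Complex.exp (Complex.I * P x) * (Complex.I * P' x)) x := fun x =>
    (((h1 x).ofReal_comp).const_mul Complex.I).cexp
  have hEc : Continuous fun x => Complex.exp (Complex.I * P x) := by fun_prop
  have hnorm : ∀ x, ‖Complex.exp (Complex.I * P x)‖ = 1 := fun x => by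
    rw [mul_comm, Complex.norm_exp_ofReal_mul_I]
  have hI1 : IntervalIntegrable (fun x => -P'' x / P' x ^ 2) volume a b :=
    (hcont.mono (by rw [Set.uIcc_of_le hab])).intervalIntegrable
  have hI2 : IntervalIntegrable
      (fun x => Complex.exp (Complex.I * P x) * ((-P'' x / P' x ^ 2 : ℝ) : ℂ)) volume a b := by
    apply ContinuousOn.intervalIntegrable
    rw [Set.uIcc_of_le hab]
    exact hEc.continuousOn.mul (Complex.continuous_ofReal.comp_continuousOn hcont)
  have hI3 : IntervalIntegrable
      (fun x => Complex.I * Complex.exp (Complex.I * P x)) volume a b :=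
    (continuous_const.mul hEc).intervalIntegrable _ _
  have key : ∫ x in a..b, (Complex.I * Complex.exp (Complex.I * P x) +
      Complex.exp (Complex.I * P x) * ((-P'' x / P' x ^ 2 : ℝ) : ℂ)) =
      Complex.exp (Complex.I * P b) * (((P' b)⁻¹ : ℝ) : ℂ) -
      Complex.exp (Complex.I * P a) * (((P' a)⁻¹ : ℝ) : ℂ) := by
    apply intervalIntegral.integral_eq_sub_of_hasDerivAt _ (hI3.add hI2)
    intro x hx
    rw [Set.uIcc_of_le hab] at hx
    convert! (hE x).mul (hd x hx).ofReal_comp using 1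
    have : (P' x : ℂ) ≠ 0 := by exact_mod_cast hne x hx
    push_cast
    field_simp
  rw [intervalIntegral.integral_add hI3 hI2, intervalIntegral.integral_const_mul] at key
  have hJ : ‖∫ x in a..b, Complex.exp (Complex.I * P x) * ((-P'' x / P' x ^ 2 : ℝ) : ℂ)‖
      ≤ 2 / l := by
    refine (intervalIntegral.norm_integral_le_of_norm_le (g := fun x => -(-P'' x / P' x ^ 2))
      hab ?_ hI1.neg).trans ?_
    · filter_upwards with x hx
      rw [norm_mul, hnorm, one_mul, Complex.norm_real, Real.norm_eq_abs, neg_div, neg_neg,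
        abs_neg, abs_of_nonneg]
      exact div_nonneg (hP'' x ⟨hx.1.le, hx.2⟩) (sq_nonneg _)
    · rw [intervalIntegral.integral_neg, intervalIntegral.integral_eq_sub_of_hasDerivAt
        (f := fun y => (P' y)⁻¹) (fun x hx => hd x (by rwa [Set.uIcc_of_le hab] at hx)) hI1]
      have h1 := abs_le.1 (hinv a ⟨le_rfl, hab⟩)
      have h2 := abs_le.1 (hinv b ⟨hab, le_rfl⟩)
      have : 2 / l = 1 / l + 1 / l := by ring
      linarith [h1.1, h1.2, h2.1, h2.2]
  have hB : ∀ x ∈ Set.Icc a b,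
      ‖Complex.exp (Complex.I * P x) * (((P' x)⁻¹ : ℝ) : ℂ)‖ ≤ 1 / l := fun x hx => by
    rw [norm_mul, hnorm, one_mul, Complex.norm_real]
    exact hinv x hx
  calc ‖∫ x in a..b, Complex.exp (Complex.I * P x)‖
      = ‖Complex.I * ∫ x in a..b, Complex.exp (Complex.I * P x)‖ := by simp
    _ = ‖Complex.exp (Complex.I * P b) * (((P' b)⁻¹ : ℝ) : ℂ) -
      Complex.exp (Complex.I * P a) * (((P' a)⁻¹ : ℝ) : ℂ) -
        ∫ x in a..b, Complex.exp (Complex.I * P x) * ((-P'' x / P' x ^ 2 : ℝ) : ℂ)‖ := by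
        rw [← key]; congr 1; ring
    _ ≤ (1 / l + 1 / l) + 2 / l := by
        refine (norm_sub_le _ _).trans (add_le_add ((norm_sub_le _ _).trans
          (add_le_add (hB b ⟨hab, le_rfl⟩) (hB a ⟨le_rfl, hab⟩))) hJ)
    _ = 4 / l := by ring

/-- Bounding an integral by cutting out a `d`-neighbourhood of a point `c`. -/
lemma norm_integral_le_of_cut {f : ℝ → ℂ} (hf : Continuous f) (hf1 : ∀ x, ‖f x‖ ≤ 1)
    {a b c d M : ℝ} (hab : a ≤ b) (hd : 0 ≤ d) (hM : 0 ≤ M)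
    (h : ∀ u v, a ≤ u → u ≤ v → v ≤ b → (v ≤ c - d ∨ c + d ≤ u) → ‖∫ x in u..v, f x‖ ≤ M) :
    ‖∫ x in a..b, f x‖ ≤ 2 * M + 2 * d := by
  have hi : ∀ u v, IntervalIntegrable f volume u v := fun u v => hf.intervalIntegrable u v
  obtain ⟨α, hα⟩ : ∃ α, α = min b (max a (c - d)) := ⟨_, rfl⟩
  obtain ⟨β, hβ⟩ : ∃ β, β = max a (min b (c + d)) := ⟨_, rfl⟩
  have ha : a ≤ α := by rw [hα]; exact le_min hab (le_max_left _ _)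
  have hb : β ≤ b := by rw [hβ]; exact max_le hab (min_le_left _ _)
  have hαb : α ≤ b := by rw [hα]; exact min_le_left _ _
  have haβ : a ≤ β := by rw [hβ]; exact le_max_left _ _
  have h1 : ‖∫ x in a..α, f x‖ ≤ M := by
    rcases le_total a (c - d) with hc | hc
    · refine h a α le_rfl ha hαb (Or.inl ?_)
      rw [hα, max_eq_right hc]
      exact min_le_right _ _
    · have : α = a := by rw [hα, max_eq_left hc, min_eq_right hab]
      simpa [this] using hM
  have h2 : ‖∫ x in β..b, f x‖ ≤ M := by
    rcases le_total (c + d) b with hc | hc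
    · refine h β b haβ hb le_rfl (Or.inr ?_)
      rw [hβ, min_eq_right hc]
      exact le_max_right _ _
    · have : β = b := by rw [hβ, min_eq_left hc, max_eq_right hab]
      simpa [this] using hM
  have h3 : ‖∫ x in α..β, f x‖ ≤ 2 * d := by
    refine (intervalIntegral.norm_integral_le_of_norm_le_const fun x _ => hf1 x).trans ?_
    rw [one_mul, hα, hβ, abs_le]
    constructor
    · rcases max_cases a (min b (c + d)) with h | h <;> rcases min_cases b (c + d) with h' | h' <;>
      rcases max_cases a (c - d) with h'' | h'' <;>
      rcases min_cases b (max a (c - d)) with h3 | h3 <;> linarith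
    · rcases max_cases a (min b (c + d)) with h | h <;> rcases min_cases b (c + d) with h' | h' <;>
      rcases max_cases a (c - d) with h'' | h'' <;>
      rcases min_cases b (max a (c - d)) with h3 | h3 <;> linarith
  rw [← intervalIntegral.integral_add_adjacent_intervals (hi a α) (hi α b),
    ← intervalIntegral.integral_add_adjacent_intervals (hi α β) (hi β b)]
  refine (norm_add_le _ _).trans ?_
  have := norm_add_le (∫ x in α..β, f x) (∫ x in β..b, f x)
  linarith

/-- Second-derivative van der Corput estimate. -/
lemma vdc_second {P P' P'' : ℝ → ℝ} (h1 : ∀ x, HasDerivAt P (P' x) x)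
    (h2 : ∀ x, HasDerivAt P' (P'' x) x) (hc : Continuous P'') {a b l : ℝ} (hab : a ≤ b)
    (hl : 0 < l) (hP'' : ∀ x ∈ Set.Icc a b, l ≤ P'' x) :
    ‖∫ x in a..b, Complex.exp (Complex.I * P x)‖ ≤ 10 / √l := by
  have hP'c : Continuous P' := continuous_iff_continuousAt.2 fun x => (h2 x).continuousAt
  have hPc : Continuous P := continuous_iff_continuousAt.2 fun x => (h1 x).continuousAt
  have hgrow : ∀ x ∈ Set.Icc a b, ∀ y ∈ Set.Icc a b, x ≤ y → l * (y - x) ≤ P' y - P' x := by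
    apply (convex_Icc a b).mul_sub_le_image_sub_of_le_deriv hP'c.continuousOn
      (fun x _ => (h2 x).differentiableAt.differentiableWithinAt)
    intro x hx
    rw [(h2 x).deriv]
    exact hP'' x (interior_subset hx)
  obtain ⟨c, hcl⟩ : ∃ c, ∀ x ∈ Set.Icc a b, l * |x - c| ≤ |P' x| := by
    rcases le_total 0 (P' a) with ha | ha
    · refine ⟨a, fun x hx => ?_⟩
      rw [abs_of_nonneg (sub_nonneg.2 hx.1)]
      have := hgrow a ⟨le_rfl, hab⟩ x hx hx.1
      exact le_trans (by linarith) (le_abs_self _)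
    rcases le_total (P' b) 0 with hb | hb
    · refine ⟨b, fun x hx => ?_⟩
      rw [abs_of_nonpos (sub_nonpos.2 hx.2)]
      have := hgrow x hx b ⟨hab, le_rfl⟩ hx.2
      exact le_trans (by linarith) (neg_le_abs _)
    obtain ⟨c, hc, hc0⟩ := intermediate_value_Icc hab hP'c.continuousOn ⟨ha, hb⟩
    refine ⟨c, fun x hx => ?_⟩
    rcases le_total c x with hcx | hcx
    · rw [abs_of_nonneg (sub_nonneg.2 hcx)]
      have := hgrow c hc x hx hcx
      exact le_trans (by linarith) (le_abs_self _)
    · rw [abs_of_nonpos (sub_nonpos.2 hcx)]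
      have := hgrow x hx c hc hcx
      exact le_trans (by linarith) (neg_le_abs _)
  have hsq : 0 < √l := Real.sqrt_pos.2 hl
  have hll : √l * √l = l := Real.mul_self_sqrt hl.le
  have hd : 0 < 1 / √l := by positivity
  have hld : l * (1 / √l) = √l := by
    rw [mul_one_div, div_eq_iff hsq.ne', hll]
  refine (norm_integral_le_of_cut (c := c) (d := 1 / √l) (M := 4 / √l) (by fun_prop) (fun x => ?_)
    hab hd.le (by positivity) ?_).trans (le_of_eq (by ring))
  · rw [mul_comm, Complex.norm_exp_ofReal_mul_I]
  intro u v hau huv hvb hcase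
  apply vdc_first h1 h2 hc huv hsq
  · intro x hx
    refine le_trans ?_ (hcl x ⟨hau.trans hx.1, hx.2.trans hvb⟩)
    rw [← hld]
    refine mul_le_mul_of_nonneg_left ?_ hl.le
    rw [hll] at *
    rcases hcase with h | h
    · exact le_trans (by linarith [hx.2]) (neg_le_abs _)
    · exact le_trans (by linarith [hx.1]) (le_abs_self _)
  · intro x hx
    exact hl.le.trans (hP'' x ⟨hau.trans hx.1, hx.2.trans hvb⟩)

lemma norm_integral_cexp_neg (P : ℝ → ℝ) (a b : ℝ) :
    ‖∫ x in a..b, Complex.exp (Complex.I * ((-P x : ℝ) : ℂ))‖ =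
      ‖∫ x in a..b, Complex.exp (Complex.I * P x)‖ := by
  have : ∀ x, Complex.exp (Complex.I * ((-P x : ℝ) : ℂ)) =
      (starRingEnd ℂ) (Complex.exp (Complex.I * P x)) := fun x => by
    simp [← Complex.exp_conj]
  simp_rw [this, intervalIntegral.intervalIntegral_eq_integral_uIoc, integral_conj, norm_smul,
    RCLike.norm_conj]

/-- Uniform decay of oscillatory integrals with cubic phase. -/
lemma vdc_cubic {α : ℝ} (hα : α ≠ 0) (β γ : ℝ) {a b : ℝ} (hab : a ≤ b) :
    ‖∫ x in a..b, Complex.exp (Complex.I * ((α * x ^ 3 + β * x ^ 2 + γ * x : ℝ) : ℂ))‖ ≤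
      12 * |α| ^ (-(1 / 3) : ℝ) := by
  wlog hpos : 0 < α generalizing α β γ
  · have := this (neg_ne_zero.2 hα) (-β) (-γ)
      (neg_pos.2 (lt_of_le_of_ne (not_lt.1 hpos) hα))
    rw [abs_neg] at this
    rw [← norm_integral_cexp_neg]
    convert! this using 6
    push_cast
    ring
  rw [abs_of_pos hpos]
  obtain ⟨d, hd⟩ : ∃ d, d = α ^ (-(1 / 3) : ℝ) := ⟨_, rfl⟩
  have hd0 : 0 < d := hd ▸ Real.rpow_pos_of_pos hpos _
  have hαd : α * d * d ^ 2 = 1 := by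
    have : d ^ 3 = α⁻¹ := by
      rw [hd, ← Real.rpow_natCast, ← Real.rpow_mul hpos.le, ← Real.rpow_neg_one]
      norm_num
    calc α * d * d ^ 2 = α * d ^ 3 := by ring
      _ = 1 := by rw [this, mul_inv_cancel₀ hα]
  rw [← hd]
  have hder1 : ∀ x, HasDerivAt (fun x : ℝ => α * x ^ 3 + β * x ^ 2 + γ * x)
      (3 * α * x ^ 2 + 2 * β * x + γ) x := fun x => by
    have := (((hasDerivAt_pow 3 x).const_mul α).add ((hasDerivAt_pow 2 x).const_mul β)).add
      ((hasDerivAt_id x).const_mul γ)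
    convert! this using 1
    push_cast
    ring
  have hder2 : ∀ x, HasDerivAt (fun x : ℝ => 3 * α * x ^ 2 + 2 * β * x + γ)
      (6 * α * x + 2 * β) x := fun x => by
    have := (((hasDerivAt_pow 2 x).const_mul (3 * α)).add
      ((hasDerivAt_id x).const_mul (2 * β))).add_const γ
    convert! this using 1
    push_cast
    ring
  have hM : 10 / √(6 * α * d) ≤ 5 * d := by
    have h4 : 2 / d ≤ √(6 * α * d) := by
      apply Real.le_sqrt_of_sq_le
      rw [div_pow, div_le_iff₀ (by positivity)]
      linarith
    have h5 : 0 < 2 / d := by positivity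
    calc 10 / √(6 * α * d) ≤ 10 / (2 / d) := by gcongr
      _ = 5 * d := by field_simp; norm_num
  have hl : 0 < 6 * α * d := by positivity
  refine (norm_integral_le_of_cut (c := -β / (3 * α)) (d := d) (M := 5 * d) (by fun_prop)
    (fun x => ?_) hab hd0.le (by positivity) ?_).trans (le_of_eq (by ring))
  · rw [mul_comm, Complex.norm_exp_ofReal_mul_I]
  intro u v _ huv _ hcase
  have hval : ∀ x, 6 * α * x + 2 * β = 6 * α * (x - -β / (3 * α)) := fun x => by
    field_simp
    ring
  rcases hcase with h | h
  · rw [← norm_integral_cexp_neg]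
    refine (vdc_second (P := fun x => -(α * x ^ 3 + β * x ^ 2 + γ * x)) (fun x => (hder1 x).neg)
      (fun x => (hder2 x).neg) (by fun_prop) huv hl fun x hx => ?_).trans hM
    rw [hval, ← mul_neg]
    exact mul_le_mul_of_nonneg_left (by linarith [hx.2]) (by positivity)
  · refine (vdc_second hder1 hder2 (by fun_prop) huv hl fun x hx => ?_).trans hM
    rw [hval]
    exact mul_le_mul_of_nonneg_left (by linarith [hx.1]) (by positivity)

lemma continuous_phase (ν μ : ℝ) : Continuous (phase ν μ) := by
  unfold phase
  fun_prop

/-- Dispersive decay of the truncated Benjamin kernel. -/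
lemma norm_kernel_le (ν : ℝ) {μ : ℝ} (hμ : μ ≠ 0) {t : ℝ} (ht : t ≠ 0) (x : ℝ) {R : ℝ}
    (hR : 0 ≤ R) :
    ‖∫ ξ in (-R)..R, Complex.exp (Complex.I * ((x * ξ + t * phase ν μ ξ : ℝ) : ℂ))‖ ≤
      24 * |μ| ^ (-(1 / 3) : ℝ) * |t| ^ (-(1 / 3) : ℝ) := by
  have hc := continuous_phase ν μ
  have hi : ∀ u v, IntervalIntegrable
      (fun ξ => Complex.exp (Complex.I * ((x * ξ + t * phase ν μ ξ : ℝ) : ℂ))) volume u v :=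
    fun u v => Continuous.intervalIntegrable (by fun_prop) _ _
  rw [← intervalIntegral.integral_add_adjacent_intervals (hi (-R) 0) (hi 0 R)]
  have hne : t * μ ≠ 0 := mul_ne_zero ht hμ
  have e1 := vdc_cubic hne (t * ν) x (neg_nonpos.2 hR)
  have e2 := vdc_cubic hne (-(t * ν)) x hR
  have f1 : ∫ ξ in (-R)..0, Complex.exp (Complex.I * ((x * ξ + t * phase ν μ ξ : ℝ) : ℂ)) =
      ∫ ξ in (-R)..0, Complex.exp (Complex.I *
        ((t * μ * ξ ^ 3 + t * ν * ξ ^ 2 + x * ξ : ℝ) : ℂ)) := by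
    refine intervalIntegral.integral_congr fun ξ hξ => ?_
    rw [Set.uIcc_of_le (neg_nonpos.2 hR)] at hξ
    simp only [phase, abs_of_nonpos hξ.2]
    congr 3
    ring
  have f2 : ∫ ξ in 0..R, Complex.exp (Complex.I * ((x * ξ + t * phase ν μ ξ : ℝ) : ℂ)) =
      ∫ ξ in 0..R, Complex.exp (Complex.I *
        ((t * μ * ξ ^ 3 + -(t * ν) * ξ ^ 2 + x * ξ : ℝ) : ℂ)) := by
    refine intervalIntegral.integral_congr fun ξ hξ => ?_
    rw [Set.uIcc_of_le hR] at hξ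
    simp only [phase, abs_of_nonneg hξ.1]
    congr 3
    ring
  rw [← f1] at e1
  rw [← f2] at e2
  refine (norm_add_le _ _).trans ((add_le_add e1 e2).trans (le_of_eq ?_))
  rw [abs_mul, Real.mul_rpow (abs_nonneg _) (abs_nonneg _)]
  ring

open FourierTransform SchwartzMap in
/-- The `L²` Fourier transform is given by the Fourier integral on `L¹ ∩ L²`. -/
lemma coeFn_fourier_toLp {g : ℝ → ℂ} (h1 : Integrable g) (h2 : MemLp g 2) :
    ((𝓕 (h2.toLp g) : Lp ℂ 2 (volume : Measure ℝ)) : ℝ → ℂ) =ᵐ[volume] 𝓕 g := by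
  have hcont : Continuous (𝓕 g) := VectorFourier.fourierIntegral_continuous
    Real.continuous_fourierChar (by exact continuous_inner) h1
  refine ae_eq_of_integral_contDiff_smul_eq
    ((Lp.memLp _).locallyIntegrable (by norm_num)) hcont.locallyIntegrable ?_
  intro φ hφ hφc
  obtain ⟨ψ, hψ⟩ : ∃ ψ : 𝓢(ℝ, ℂ), ∀ x, ψ x = (φ x : ℂ) :=
    ⟨(hφc.comp_left (g := ((↑) : ℝ → ℂ)) rfl).toSchwartzMap
      (Complex.ofRealCLM.contDiff.comp hφ), fun x => rfl⟩
  have e1 : ∫ x, ψ x • ((𝓕 (h2.toLp g) : Lp ℂ 2 (volume : Measure ℝ)) : ℝ → ℂ) x =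
      ∫ x, (𝓕 ψ) x • (h2.toLp g : ℝ → ℂ) x := by
    rw [← Lp.toTemperedDistribution_apply, ← Lp.toTemperedDistribution_apply,
      ← Lp.fourier_toTemperedDistribution_eq, TemperedDistribution.fourier_apply]
  have e2 : ∫ x, (𝓕 ψ) x • (h2.toLp g : ℝ → ℂ) x = ∫ x, (𝓕 ψ) x • g x := by
    refine integral_congr_ae ?_
    filter_upwards [h2.coeFn_toLp] with x hx
    rw [hx]
  have e3 : ∫ x, (𝓕 ψ) x • g x = ∫ x, ψ x • 𝓕 g x := by
    have := VectorFourier.integral_fourierIntegral_smul_eq_flip (L := innerₗ ℝ)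
      (μ := volume) (ν := volume) Real.continuous_fourierChar (by exact continuous_inner)
      ψ.integrable h1
    rw [flip_innerₗ] at this
    exact this
  simp only [hψ] at e1 e2 e3
  simpa only [Complex.real_smul, smul_eq_mul] using (e1.trans (e2.trans e3))

lemma lintegral_enorm_sq_eq {α : Type*} [MeasurableSpace α] {m : Measure α} (f : α → ℂ) :
    ∫⁻ x, ‖f x‖ₑ ^ 2 ∂m = eLpNorm f 2 m ^ 2 := by
  have := eLpNorm_nnreal_pow_eq_lintegral (f := f) (μ := m) (p := 2) (by norm_num)
  simpa using this.symm

open FourierTransform in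
lemma lintegral_fourier_sq {g : ℝ → ℂ} (h1 : Integrable g) (h2 : MemLp g 2) :
    ∫⁻ x, ‖𝓕 g x‖ₑ ^ 2 = ∫⁻ x, ‖g x‖ₑ ^ 2 := by
  rw [lintegral_enorm_sq_eq, lintegral_enorm_sq_eq,
    ← eLpNorm_congr_ae (coeFn_fourier_toLp h1 h2), ← eLpNorm_congr_ae h2.coeFn_toLp,
    ← Lp.enorm_def, ← Lp.enorm_def, enorm_eq_iff_norm_eq.2 (Lp.norm_fourier_eq _)]

lemma lintegral_comp_const_mul {f : ℝ → ℝ≥0∞} (c : ℝ) (hc : 0 < c) :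
    ∫⁻ x, f (c * x) = ENNReal.ofReal c⁻¹ * ∫⁻ x, f x := by
  have h := Real.map_volume_mul_left hc.ne'
  rw [abs_of_pos (inv_pos.2 hc)] at h
  rw [← smul_eq_mul, ← lintegral_smul_measure, ← h,
    (measurableEmbedding_mulLeft₀ hc.ne').lintegral_map]

open FourierTransform in
lemma FT_eq_fourier (g : ℝ → ℂ) (ξ : ℝ) : FT g ξ = 𝓕 g ((2 * π)⁻¹ * ξ) := by
  rw [Real.fourier_real_eq_integral_exp_smul, FT]
  refine integral_congr_ae (Filter.Eventually.of_forall fun x => ?_)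
  simp only [smul_eq_mul]
  congr 2
  push_cast
  have : (π : ℂ) ≠ 0 := by exact_mod_cast Real.pi_ne_zero
  field_simp

lemma continuous_FT {g : ℝ → ℂ} (h1 : Integrable g) : Continuous (FT g) := by
  have hcont : Continuous (FourierTransform.fourier g) := VectorFourier.fourierIntegral_continuous
    Real.continuous_fourierChar (by exact continuous_inner) h1
  rw [funext (FT_eq_fourier g)]
  fun_prop

lemma lintegral_FT_sq {g : ℝ → ℂ} (h1 : Integrable g) (h2 : MemLp g 2) :
    ∫⁻ ξ, ‖FT g ξ‖ₑ ^ 2 = ENNReal.ofReal (2 * π) * ∫⁻ x, ‖g x‖ₑ ^ 2 := by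
  simp_rw [FT_eq_fourier]
  rw [lintegral_comp_const_mul (f := fun ξ => ‖FourierTransform.fourier g ξ‖ₑ ^ 2) _
    (by positivity), lintegral_fourier_sq h1 h2, inv_inv]

lemma norm_cexp_I (r : ℝ) : ‖Complex.exp (Complex.I * r)‖ = 1 := by
  rw [mul_comm, Complex.norm_exp_ofReal_mul_I]

/-- The free group truncated to frequencies `|ξ| ≤ R`, without normalisation. -/
def truncGrp (ν μ R t : ℝ) (g : ℝ → ℂ) (y : ℝ) : ℂ :=
  ∫ ξ in (-R)..R, Complex.exp (Complex.I * ((y * ξ + t * phase ν μ ξ : ℝ) : ℂ)) * FT g ξ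

lemma norm_FT_le (g : ℝ → ℂ) (ξ : ℝ) : ‖FT g ξ‖ ≤ ∫ x, ‖g x‖ := by
  refine (norm_integral_le_integral_norm _).trans (le_of_eq ?_)
  congr 1 with x
  have := norm_cexp_I (-(ξ * x))
  push_cast at this
  rw [norm_mul, show -(Complex.I * ξ * x) = Complex.I * -(ξ * x) by ring, this, one_mul]

lemma FT_add {f g : ℝ → ℂ} (hf : Integrable f) (hg : Integrable g) (ξ : ℝ) :
    FT (f + g) ξ = FT f ξ + FT g ξ := by
  have key : ∀ f : ℝ → ℂ, Integrable f →
      Integrable fun x : ℝ => Complex.exp (-(Complex.I * ξ * x)) * f x := fun f hf => by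
    refine hf.bdd_mul (c := 1) (by fun_prop) (Filter.Eventually.of_forall fun x => ?_)
    have := norm_cexp_I (-(ξ * x))
    push_cast at this
    rw [show -(Complex.I * ξ * x) = Complex.I * -(ξ * x) by ring, this]
  rw [FT, FT, FT, ← integral_add (key f hf) (key g hg)]
  simp [mul_add]

lemma truncGrp_add (ν μ R t : ℝ) {f g : ℝ → ℂ} (hf : Integrable f) (hg : Integrable g) (y : ℝ) :
    truncGrp ν μ R t (f + g) y = truncGrp ν μ R t f y + truncGrp ν μ R t g y := by
  have := continuous_FT hf
  have := continuous_FT hg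
  have := continuous_phase ν μ
  rw [truncGrp, truncGrp, truncGrp, ← intervalIntegral.integral_add
    (Continuous.intervalIntegrable (by fun_prop) _ _)
    (Continuous.intervalIntegrable (by fun_prop) _ _)]
  simp_rw [FT_add hf hg, mul_add]

/-- `truncGrp` is a Fourier transform of a compactly supported function. -/
lemma truncGrp_eq_FT (ν μ t : ℝ) {R : ℝ} (hR : 0 ≤ R) (g : ℝ → ℂ) (y : ℝ) :
    truncGrp ν μ R t g y = FT ((Set.Ioc (-R) R).indicator fun ξ =>
      Complex.exp (Complex.I * ((t * phase ν μ ξ : ℝ) : ℂ)) * FT g ξ) (-y) := by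
  rw [truncGrp, intervalIntegral.integral_of_le (by linarith), FT,
    ← integral_indicator measurableSet_Ioc]
  congr 1 with ξ
  by_cases h : ξ ∈ Set.Ioc (-R) R
  · rw [Set.indicator_of_mem h, Set.indicator_of_mem h, ← mul_assoc, ← Complex.exp_add]
    congr 2
    push_cast
    ring
  · simp [Set.indicator_of_notMem h]

lemma integrable_truncated (ν μ t R : ℝ) {g : ℝ → ℂ} (h1 : Integrable g) :
    Integrable ((Set.Ioc (-R) R).indicator fun ξ =>
      Complex.exp (Complex.I * ((t * phase ν μ ξ : ℝ) : ℂ)) * FT g ξ) := by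
  have := continuous_FT h1
  have := continuous_phase ν μ
  rw [integrable_indicator_iff measurableSet_Ioc]
  exact Continuous.integrableOn_Ioc (by fun_prop)

lemma continuous_truncGrp (ν μ t : ℝ) {R : ℝ} (hR : 0 ≤ R) {g : ℝ → ℂ} (h1 : Integrable g) :
    Continuous (truncGrp ν μ R t g) := by
  rw [funext (truncGrp_eq_FT ν μ t hR g)]
  exact (continuous_FT (integrable_truncated ν μ t R h1)).comp continuous_neg

lemma lintegral_truncGrp_sq_le (ν μ t : ℝ) {R : ℝ} (hR : 0 ≤ R) {g : ℝ → ℂ} (h1 : Integrable g)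
    (h2 : MemLp g 2) :
    ∫⁻ y, ‖truncGrp ν μ R t g y‖ₑ ^ 2 ≤ ENNReal.ofReal (2 * π) ^ 2 * ∫⁻ x, ‖g x‖ₑ ^ 2 := by
  have hint := integrable_truncated ν μ t R h1
  have hle : ∀ ξ, ‖(Set.Ioc (-R) R).indicator (fun ξ =>
      Complex.exp (Complex.I * ((t * phase ν μ ξ : ℝ) : ℂ)) * FT g ξ) ξ‖ₑ ≤ ‖FT g ξ‖ₑ := by
    intro ξ
    refine (enorm_indicator_le_enorm_self _ _).trans ?_
    rw [enorm_mul, ← ofReal_norm, norm_cexp_I]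
    simp
  have hL : ∫⁻ ξ, ‖(Set.Ioc (-R) R).indicator (fun ξ =>
      Complex.exp (Complex.I * ((t * phase ν μ ξ : ℝ) : ℂ)) * FT g ξ) ξ‖ₑ ^ 2 ≤
      ENNReal.ofReal (2 * π) * ∫⁻ x, ‖g x‖ₑ ^ 2 := by
    rw [← lintegral_FT_sq h1 h2]
    exact lintegral_mono fun ξ => by gcongr; exact hle ξ
  have hmem : MemLp ((Set.Ioc (-R) R).indicator fun ξ =>
      Complex.exp (Complex.I * ((t * phase ν μ ξ : ℝ) : ℂ)) * FT g ξ) 2 := by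
    refine ⟨hint.1, ?_⟩
    have h3 : eLpNorm g 2 volume ^ 2 < ∞ := ENNReal.pow_lt_top h2.2
    rw [lintegral_enorm_sq_eq, lintegral_enorm_sq_eq] at hL
    have := hL.trans_lt (ENNReal.mul_lt_top ENNReal.ofReal_lt_top h3)
    exact (ENNReal.pow_lt_top_iff.1 this).resolve_right (by norm_num)
  simp_rw [truncGrp_eq_FT ν μ t hR g]
  rw [(Measure.measurePreserving_neg (volume : Measure ℝ)).lintegral_comp_emb
    (MeasurableEquiv.neg ℝ).measurableEmbedding (fun y => ‖FT _ y‖ₑ ^ 2),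
    lintegral_FT_sq hint hmem, sq (ENNReal.ofReal _), mul_assoc]
  gcongr

lemma norm_truncGrp_le (ν : ℝ) {μ : ℝ} (hμ : μ ≠ 0) {t : ℝ} (ht : t ≠ 0) {R : ℝ} (hR : 0 ≤ R)
    {g : ℝ → ℂ} (h1 : Integrable g) (y : ℝ) :
    ‖truncGrp ν μ R t g y‖ ≤
      24 * |μ| ^ (-(1 / 3) : ℝ) * |t| ^ (-(1 / 3) : ℝ) * ∫ x, ‖g x‖ := by
  have hph := continuous_phase ν μ
  have e1 : truncGrp ν μ R t g y = ∫ ξ in (-R)..R, ∫ x, Complex.exp (Complex.I *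
      (((y - x) * ξ + t * phase ν μ ξ : ℝ) : ℂ)) * g x := by
    rw [truncGrp]
    refine intervalIntegral.integral_congr fun ξ _ => ?_
    simp only [FT]
    rw [← integral_const_mul]
    congr 1 with x
    rw [← mul_assoc, ← Complex.exp_add]
    congr 2
    push_cast
    ring
  have : IsFiniteMeasure (volume.restrict (Set.uIoc (-R) R)) :=
    ⟨by
      rw [Measure.restrict_apply_univ, Set.uIoc_of_le (by linarith), Real.volume_Ioc]
      exact ENNReal.ofReal_lt_top⟩
  have hint : Integrable (Function.uncurry fun (ξ x : ℝ) => Complex.exp (Complex.I *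
      (((y - x) * ξ + t * phase ν μ ξ : ℝ) : ℂ)) * g x)
      ((volume.restrict (Set.uIoc (-R) R)).prod volume) := by
    have h3 : Integrable (fun z : ℝ × ℝ => g z.2)
        ((volume.restrict (Set.uIoc (-R) R)).prod volume) := h1.comp_snd _
    refine h3.bdd_mul (c := 1) (Continuous.aestronglyMeasurable (by fun_prop))
      (Filter.Eventually.of_forall fun z => ?_)
    exact (norm_cexp_I _).le
  rw [e1, intervalIntegral_integral_swap hint, ← integral_const_mul]
  refine norm_integral_le_of_norm_le (h1.norm.const_mul _) (Filter.Eventually.of_forall fun x => ?_)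
  rw [intervalIntegral.integral_mul_const, norm_mul]
  exact mul_le_mul_of_nonneg_right (norm_kernel_le ν hμ ht (y - x) hR) (norm_nonneg _)

lemma lintegral_Ioc_rpow {L r : ℝ} (hL : 0 ≤ L) (hr : -1 < r) :
    ∫⁻ x in Set.Ioc 0 L, ENNReal.ofReal (x ^ r) = ENNReal.ofReal (L ^ (r + 1) / (r + 1)) := by
  have h1 : IntegrableOn (fun x : ℝ => x ^ r) (Set.Ioc 0 L) :=
    (intervalIntegrable_iff_integrableOn_Ioc_of_le hL).1
      (intervalIntegral.intervalIntegrable_rpow' hr)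
  rw [← ofReal_integral_eq_lintegral_ofReal h1, ← intervalIntegral.integral_of_le hL,
    integral_rpow (Or.inl hr), Real.zero_rpow (by linarith), sub_zero]
  filter_upwards [ae_restrict_mem measurableSet_Ioc] with x hx
  exact Real.rpow_nonneg hx.1.le _

/-- The part of an `L^p` function above height `η` has controlled `L¹` norm. -/
lemma integral_norm_indicator_gt_le {g : ℝ → ℂ} {p η : ℝ} (hp : 1 ≤ p)
    (hη : 0 < η) (hgp : Integrable fun x => ‖g x‖ ^ p) :
    ∫ x, ‖{x | η < ‖g x‖}.indicator g x‖ ≤ η ^ (1 - p) * ∫ x, ‖g x‖ ^ p := by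
  rw [← integral_const_mul]
  refine integral_mono_of_nonneg (Filter.Eventually.of_forall fun x => norm_nonneg _)
    (hgp.const_mul _) (Filter.Eventually.of_forall fun x => ?_)
  by_cases h : η < ‖g x‖
  · have h0 : 0 < ‖g x‖ := hη.trans h
    have e : ‖g x‖ = ‖g x‖ ^ (1 - p) * ‖g x‖ ^ p := by
      rw [← Real.rpow_add h0]
      simp
    simp only [Set.mem_ofPred_eq, h, Set.indicator_of_mem]
    calc ‖g x‖ = ‖g x‖ ^ (1 - p) * ‖g x‖ ^ p := e
      _ ≤ _ := mul_le_mul_of_nonneg_right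
        (Real.rpow_le_rpow_of_nonpos hη h.le (by linarith)) (by positivity)
  · simp only [Set.mem_ofPred_eq, h, not_false_eq_true, Set.indicator_of_notMem, norm_zero]
    positivity

/-- A distributional estimate behind real interpolation between `L¹ → L^∞` and `L² → L²`. -/
lemma meas_lt_norm_le {T : (ℝ → ℂ) → ℝ → ℂ} {A : ℝ} {D : ℝ≥0∞} (hA : 0 < A)
    (hTadd : ∀ f g, Integrable f → Integrable g → ∀ x, T (f + g) x = T f x + T g x)
    (hTmeas : ∀ g, Integrable g → Measurable (T g))
    (hT1 : ∀ g, Integrable g → ∀ x, ‖T g x‖ ≤ A * ∫ y, ‖g y‖)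
    (hT2 : ∀ g, Integrable g → MemLp g 2 → ∫⁻ x, ‖T g x‖ₑ ^ 2 ≤ D * ∫⁻ x, ‖g x‖ₑ ^ 2)
    {q : ℝ} (hq : 2 < q) {g : ℝ → ℂ} (hg : Measurable g) (hg1 : Integrable g) (hg2 : MemLp g 2)
    (hgp : Integrable fun x => ‖g x‖ ^ (q / (q - 1))) (hn : 0 < ∫ x, ‖g x‖ ^ (q / (q - 1)))
    {l : ℝ} (hl : 0 < l) :
    volume {x | l < ‖T g x‖} ≤ ENNReal.ofReal (4 * l ^ (-2 : ℝ)) * D *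
      ∫⁻ x, {x | ‖g x‖ ≤ (2 * A * (∫ x, ‖g x‖ ^ (q / (q - 1))) / l) ^ (q - 1)}.indicator
        (fun x => ‖g x‖ₑ ^ 2) x := by
  set n := ∫ x, ‖g x‖ ^ (q / (q - 1)) with hn_def
  set η := (2 * A * n / l) ^ (q - 1) with hη_def
  have hη : 0 < η := by positivity
  have hm1 : MeasurableSet {x | η < ‖g x‖} := measurableSet_lt measurable_const hg.norm
  have hcompl : {x | η < ‖g x‖}ᶜ = {x | ‖g x‖ ≤ η} := by ext x; simp
  have hm2 : MeasurableSet {x | ‖g x‖ ≤ η} := hcompl ▸ hm1.compl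
  set g1 := {x | η < ‖g x‖}.indicator g with hg1_def
  set g2 := {x | ‖g x‖ ≤ η}.indicator g with hg2_def
  have hsum : g1 + g2 = g := by
    rw [hg1_def, hg2_def, ← hcompl, Set.indicator_self_add_compl]
  have hi1 : Integrable g1 := hg1.indicator hm1
  have hi2 : Integrable g2 := hg1.indicator hm2
  have hmem2 : MemLp g2 2 := hg2.indicator hm2
  have hηp : η ^ (1 - q / (q - 1)) = l / (2 * A * n) := by
    have : (q - 1) * (1 - q / (q - 1)) = -1 := by
      have : q - 1 ≠ 0 := by linarith
      field_simp
      ring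
    rw [hη_def, ← Real.rpow_mul (by positivity), this, Real.rpow_neg_one, inv_div]
  have hTg1 : ∀ x, ‖T g1 x‖ ≤ l / 2 := fun x => by
    have hp : 1 ≤ q / (q - 1) := by
      rw [le_div_iff₀ (by linarith)]
      linarith
    calc ‖T g1 x‖ ≤ A * ∫ y, ‖g1 y‖ := hT1 _ hi1 x
      _ ≤ A * (l / (2 * A * n) * n) := by
        rw [← hηp]
        gcongr
        exact integral_norm_indicator_gt_le hp hη hgp
      _ = l / 2 := by field_simp
  have hsub : {x | l < ‖T g x‖} ⊆ {x | ENNReal.ofReal (l ^ 2 / 4) ≤ ‖T g2 x‖ₑ ^ 2} := by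
    intro x hx
    have hx' : l < ‖T g x‖ := hx
    rw [← hsum, hTadd _ _ hi1 hi2] at hx'
    have h2 : l / 2 ≤ ‖T g2 x‖ := by
      have := norm_add_le (T g1 x) (T g2 x)
      have := hTg1 x
      linarith
    rw [Set.mem_ofPred_eq, ← ofReal_norm, ← ENNReal.ofReal_pow (norm_nonneg _)]
    refine ENNReal.ofReal_le_ofReal ?_
    nlinarith
  refine (measure_mono hsub).trans ?_
  have hmk := meas_ge_le_lintegral_div (μ := volume) (f := fun x => ‖T g2 x‖ₑ ^ 2)
    ((hTmeas g2 hi2).enorm.pow_const 2).aemeasurable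
    (ε := ENNReal.ofReal (l ^ 2 / 4)) (by simpa using by positivity) ENNReal.ofReal_ne_top
  refine hmk.trans ?_
  have hc : (ENNReal.ofReal (l ^ 2 / 4))⁻¹ = ENNReal.ofReal (4 * l ^ (-2 : ℝ)) := by
    rw [← ENNReal.ofReal_inv_of_pos (by positivity), inv_div, Real.rpow_neg hl.le]
    congr 1
    rw [div_eq_mul_inv]
    norm_num
  rw [div_eq_mul_inv, hc, mul_comm, mul_assoc]
  gcongr
  refine (hT2 _ hi2 hmem2).trans (le_of_eq ?_)
  congr 1
  refine lintegral_congr fun x => ?_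
  by_cases h : x ∈ {x | ‖g x‖ ≤ η}
  · rw [hg2_def, Set.indicator_of_mem h, Set.indicator_of_mem h]
  · rw [hg2_def, Set.indicator_of_notMem h, Set.indicator_of_notMem h]
    simp

/-- Real interpolation between `L¹ → L^∞` and `L² → L²`, on the line of duality. -/
lemma lintegral_rpow_le_of_interpolation {T : (ℝ → ℂ) → ℝ → ℂ} {A : ℝ} {D : ℝ≥0∞} (hA : 0 < A)
    (hTadd : ∀ f g, Integrable f → Integrable g → ∀ x, T (f + g) x = T f x + T g x)
    (hTmeas : ∀ g, Integrable g → Measurable (T g))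
    (hT1 : ∀ g, Integrable g → ∀ x, ‖T g x‖ ≤ A * ∫ y, ‖g y‖)
    (hT2 : ∀ g, Integrable g → MemLp g 2 → ∫⁻ x, ‖T g x‖ₑ ^ 2 ≤ D * ∫⁻ x, ‖g x‖ₑ ^ 2)
    {q : ℝ} (hq : 2 < q) {g : ℝ → ℂ} (hg : Measurable g) (hg1 : Integrable g) (hg2 : MemLp g 2)
    (hgp : Integrable fun x => ‖g x‖ ^ (q / (q - 1))) :
    ∫⁻ x, ‖T g x‖ₑ ^ q ≤ ENNReal.ofReal (4 * q / (q - 2) * (2 * A) ^ (q - 2)) * D *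
      ENNReal.ofReal (∫ x, ‖g x‖ ^ (q / (q - 1))) ^ (q - 1) := by
  have hn0 : 0 ≤ ∫ x, ‖g x‖ ^ (q / (q - 1)) := integral_nonneg fun x => by positivity
  have hp0 : 0 < q / (q - 1) := div_pos (by linarith) (by linarith)
  rcases hn0.eq_or_lt with hn | hn
  · have h0 : ∀ᵐ x, ‖g x‖ = 0 := by
      have := (integral_eq_zero_iff_of_nonneg (fun x => by positivity) hgp).1 hn.symm
      filter_upwards [this] with x hx
      exact ((Real.rpow_eq_zero (norm_nonneg _) hp0.ne').1 hx)
    have hI : ∫ y, ‖g y‖ = 0 := by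
      rw [integral_congr_ae h0, integral_zero]
    have hT0 : ∀ x, T g x = 0 := fun x => by
      have := hT1 g hg1 x
      rw [hI, mul_zero] at this
      exact norm_le_zero_iff.1 this
    simp [hT0, ENNReal.zero_rpow_of_pos (show 0 < q by linarith)]
  set n := ∫ x, ‖g x‖ ^ (q / (q - 1)) with hn_def
  set K : ℝ := 2 * A * n with hK
  have hK0 : 0 < K := by positivity
  have e1 : ∫⁻ x, ‖T g x‖ₑ ^ q = ENNReal.ofReal q *
      ∫⁻ l in Set.Ioi 0, volume {x | l < ‖T g x‖} * ENNReal.ofReal (l ^ (q - 1)) := by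
    rw [← lintegral_rpow_eq_lintegral_meas_lt_mul volume
      (Filter.Eventually.of_forall fun x => norm_nonneg _) (hTmeas g hg1).norm.aemeasurable
      (by linarith)]
    refine lintegral_congr fun x => ?_
    rw [← ofReal_norm, ENNReal.ofReal_rpow_of_nonneg (norm_nonneg _) (by linarith)]
  have e2 : ∫⁻ l in Set.Ioi 0, volume {x | l < ‖T g x‖} * ENNReal.ofReal (l ^ (q - 1)) ≤
      ∫⁻ l in Set.Ioi 0, 4 * D * ∫⁻ x, {z : ℝ × ℝ | ‖g z.2‖ ≤ (K / z.1) ^ (q - 1)}.indicator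
        (fun z => ENNReal.ofReal (z.1 ^ (q - 3)) * ‖g z.2‖ₑ ^ 2) (l, x) := by
    refine setLIntegral_mono' measurableSet_Ioi fun l hl => ?_
    have hl0 : (0 : ℝ) < l := hl
    have h3 : ENNReal.ofReal (4 * l ^ (-2 : ℝ)) * ENNReal.ofReal (l ^ (q - 1)) =
        4 * ENNReal.ofReal (l ^ (q - 3)) := by
      rw [← ENNReal.ofReal_mul (by positivity), mul_assoc, ← Real.rpow_add hl0,
        ENNReal.ofReal_mul (by norm_num)]
      norm_num
      ring_nf
    calc _ ≤ (ENNReal.ofReal (4 * l ^ (-2 : ℝ)) * D *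
      ∫⁻ x, {x | ‖g x‖ ≤ (K / l) ^ (q - 1)}.indicator (fun x => ‖g x‖ₑ ^ 2) x) *
          ENNReal.ofReal (l ^ (q - 1)) := by
          gcongr
          exact meas_lt_norm_le hA hTadd hTmeas hT1 hT2 hq hg hg1 hg2 hgp hn hl0
      _ = (ENNReal.ofReal (4 * l ^ (-2 : ℝ)) * ENNReal.ofReal (l ^ (q - 1))) * D *
          ∫⁻ x, {x | ‖g x‖ ≤ (K / l) ^ (q - 1)}.indicator (fun x => ‖g x‖ₑ ^ 2) x := by ring
      _ = 4 * D * (ENNReal.ofReal (l ^ (q - 3)) *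
          ∫⁻ x, {x | ‖g x‖ ≤ (K / l) ^ (q - 1)}.indicator (fun x => ‖g x‖ₑ ^ 2) x) := by
          rw [h3]; ring
      _ = _ := by
          rw [← lintegral_const_mul' _ _ ENNReal.ofReal_ne_top]
          congr 1
          refine lintegral_congr fun x => ?_
          by_cases h : ‖g x‖ ≤ (K / l) ^ (q - 1) <;> simp [Set.indicator, h]
  have hmset : MeasurableSet {z : ℝ × ℝ | ‖g z.2‖ ≤ (K / z.1) ^ (q - 1)} :=
    measurableSet_le (by fun_prop) (by fun_prop)
  have hmF : Measurable ({z : ℝ × ℝ | ‖g z.2‖ ≤ (K / z.1) ^ (q - 1)}.indicator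
        (fun z => ENNReal.ofReal (z.1 ^ (q - 3)) * ‖g z.2‖ₑ ^ 2)) :=
    Measurable.indicator (by fun_prop) hmset
  have e3 : ∀ x, ∫⁻ l in Set.Ioi 0, {z : ℝ × ℝ | ‖g z.2‖ ≤ (K / z.1) ^ (q - 1)}.indicator
        (fun z => ENNReal.ofReal (z.1 ^ (q - 3)) * ‖g z.2‖ₑ ^ 2) (l, x) ≤
      ENNReal.ofReal (K ^ (q - 2) / (q - 2)) * ENNReal.ofReal (‖g x‖ ^ (q / (q - 1))) := by
    intro x
    rcases (norm_nonneg (g x)).eq_or_lt with h0 | h0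
    · have : g x = 0 := norm_eq_zero.1 h0.symm
      simp [Set.indicator, this]
    set s := ‖g x‖ with hs
    set L := K * s ^ (-(1 / (q - 1))) with hL
    have hL0 : 0 ≤ L := by positivity
    have hq1 : q - 1 ≠ 0 := by linarith
    calc _ ≤ ∫⁻ l in Set.Ioi 0, (Set.Ioc 0 L).indicator
          (fun l => ENNReal.ofReal (l ^ (q - 3)) * ENNReal.ofReal (s ^ 2)) l := by
          refine setLIntegral_mono' measurableSet_Ioi fun l hl => ?_
          have hl0 : (0 : ℝ) < l := hl
          by_cases h : s ≤ (K / l) ^ (q - 1)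
          · have hlL : l ≤ L := by
              have h1 := Real.rpow_le_rpow_of_nonpos h0 h
                (show -(1 / (q - 1)) ≤ 0 by
                  rw [neg_nonpos]; exact div_nonneg zero_le_one (by linarith))
              rw [← Real.rpow_mul (by positivity),
                show (q - 1) * -(1 / (q - 1)) = -1 by field_simp, Real.rpow_neg_one,
                inv_div, div_le_iff₀ hK0] at h1
              rw [hL]; linarith
            rw [Set.indicator_of_mem (s := {z : ℝ × ℝ | ‖g z.2‖ ≤ (K / z.1) ^ (q - 1)}) (a := (l, x)) h,
              Set.indicator_of_mem (show l ∈ Set.Ioc 0 L from ⟨hl0, hlL⟩),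
              ← ofReal_norm, ← ENNReal.ofReal_pow (norm_nonneg _)]
          · rw [Set.indicator_of_notMem (s := {z : ℝ × ℝ | ‖g z.2‖ ≤ (K / z.1) ^ (q - 1)}) (a := (l, x)) h]
            exact zero_le
      _ = ENNReal.ofReal (L ^ (q - 2) / (q - 2)) * ENNReal.ofReal (s ^ 2) := by
          rw [lintegral_indicator measurableSet_Ioc, Measure.restrict_restrict measurableSet_Ioc,
            Set.inter_eq_left.2 Set.Ioc_subset_Ioi_self,
            lintegral_mul_const' _ _ ENNReal.ofReal_ne_top,
            lintegral_Ioc_rpow hL0 (by linarith), show q - 3 + 1 = q - 2 by ring]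
      _ = _ := by
          rw [← ENNReal.ofReal_mul (div_nonneg (by positivity) (by linarith)),
            ← ENNReal.ofReal_mul (div_nonneg (by positivity) (by linarith))]
          congr 1
          rw [hL, Real.mul_rpow hK0.le (by positivity), ← Real.rpow_mul h0.le]
          have : s ^ (-(1 / (q - 1)) * (q - 2)) * s ^ 2 = s ^ (q / (q - 1)) := by
            rw [← Real.rpow_natCast s 2, ← Real.rpow_add h0]
            congr 1
            field_simp
            push_cast
            ring
          rw [← this]
          ring
  have hnlint : ∫⁻ x, ENNReal.ofReal (‖g x‖ ^ (q / (q - 1))) = ENNReal.ofReal n := by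
    rw [hn_def, ofReal_integral_eq_lintegral_ofReal hgp
      (Filter.Eventually.of_forall fun x => by positivity)]
  rw [e1]
  calc _ ≤ ENNReal.ofReal q * (4 * D * (ENNReal.ofReal (K ^ (q - 2) / (q - 2)) *
        ENNReal.ofReal n)) := by
        refine mul_le_mul_right ?_ _
        refine e2.trans ?_
        rw [lintegral_const_mul _ hmF.lintegral_prod_right']
        refine mul_le_mul_right ?_ _
        rw [← hnlint, ← lintegral_const_mul' _ _ ENNReal.ofReal_ne_top]
        refine le_of_eq_of_le ?_ (lintegral_mono e3)
        exact lintegral_lintegral_swap (f := fun l x =>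
          {z : ℝ × ℝ | ‖g z.2‖ ≤ (K / z.1) ^ (q - 1)}.indicator
            (fun z => ENNReal.ofReal (z.1 ^ (q - 3)) * ‖g z.2‖ₑ ^ 2) (l, x)) hmF.aemeasurable
    _ = _ := by
        rw [ENNReal.ofReal_rpow_of_nonneg hn0 (by linarith)]
        have : (4 : ℝ≥0∞) = ENNReal.ofReal 4 := by norm_num
        rw [this]
        have hq2 : 0 < q - 2 := by linarith
        have hn1 : n ^ (q - 1) = n ^ (q - 2) * n := by
          rw [show q - 1 = q - 2 + 1 by ring, Real.rpow_add_one hn.ne']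
        rw [show ENNReal.ofReal q * (ENNReal.ofReal 4 * D * (ENNReal.ofReal (K ^ (q - 2) / (q - 2)) *
          ENNReal.ofReal n)) = (ENNReal.ofReal q * ENNReal.ofReal 4 *
          ENNReal.ofReal (K ^ (q - 2) / (q - 2)) * ENNReal.ofReal n) * D by ring]
        rw [mul_right_comm (ENNReal.ofReal (4 * q / (q - 2) * (2 * A) ^ (q - 2)))]
        congr 1
        rw [← ENNReal.ofReal_mul (by linarith), ← ENNReal.ofReal_mul (by linarith),
          ← ENNReal.ofReal_mul (by positivity), ← ENNReal.ofReal_mul (by positivity)]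
        congr 1
        rw [hK, Real.mul_rpow (by positivity) hn0, hn1]
        ring

lemma lintegral_abs_eq (f : ℝ → ℝ≥0∞) :
    ∫⁻ u, f |u| = 2 * ∫⁻ u in Set.Ioi 0, f u := by
  have h1 : ∫⁻ u in Set.Ioi (0 : ℝ), f |u| = ∫⁻ u in Set.Ioi 0, f u :=
    setLIntegral_congr_fun measurableSet_Ioi fun u hu => by
      rw [abs_of_pos (show (0 : ℝ) < u from hu)]
  have h2 : ∫⁻ u in Set.Iic (0 : ℝ), f |u| = ∫⁻ u in Set.Ioi 0, f u := by
    have := (Measure.measurePreserving_neg (volume : Measure ℝ)).setLIntegral_comp_preimage_emb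
      (MeasurableEquiv.neg ℝ).measurableEmbedding (fun u => f |u|) (Set.Iio 0)
    simp only [abs_neg, Set.neg_preimage, Set.neg_Iio, neg_zero] at this
    rw [setLIntegral_congr Iio_ae_eq_Iic.symm, ← h1, this]
  rw [← lintegral_add_compl _ (measurableSet_Ioi (a := (0 : ℝ))), Set.compl_Ioi, h1, h2, two_mul]

lemma lintegral_near {γ r : ℝ} (hγ : γ < 1) (hr : 0 < r) (t : ℝ) :
    ∫⁻ s, (if |t - s| ≤ r then ENNReal.ofReal (|t - s| ^ (-γ)) else 0) =
      ENNReal.ofReal (2 * (r ^ (1 - γ) / (1 - γ))) := by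
  rw [lintegral_sub_left_eq_self
    (fun u : ℝ => if |u| ≤ r then ENNReal.ofReal (|u| ^ (-γ)) else 0) t,
    lintegral_abs_eq fun v => if v ≤ r then ENNReal.ofReal (v ^ (-γ)) else 0,
    ENNReal.ofReal_mul zero_le_two]
  have e : ∀ v : ℝ, (if v ≤ r then ENNReal.ofReal (v ^ (-γ)) else 0) =
      (Set.Iic r).indicator (fun v => ENNReal.ofReal (v ^ (-γ))) v := fun v => by
    simp [Set.indicator]
  simp_rw [e]
  rw [lintegral_indicator measurableSet_Iic, Measure.restrict_restrict measurableSet_Iic,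
    Set.inter_comm, Set.Ioi_inter_Iic, lintegral_Ioc_rpow hr.le (by linarith),
    neg_add_eq_sub, ENNReal.ofReal_ofNat]

lemma lintegral_Ioi_rpow' {a r : ℝ} (hr : r < -1) (ha : 0 < a) :
    ∫⁻ x in Set.Ioi a, ENNReal.ofReal (x ^ r) = ENNReal.ofReal (-a ^ (r + 1) / (r + 1)) := by
  rw [← ofReal_integral_eq_lintegral_ofReal (integrableOn_Ioi_rpow_of_lt hr ha),
    integral_Ioi_rpow_of_lt hr ha]
  filter_upwards [ae_restrict_mem measurableSet_Ioi] with x hx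
  exact Real.rpow_nonneg (ha.trans hx).le _

lemma lintegral_far {q r : ℝ} (hq : 0 < q) (hr : 0 < r) (t : ℝ) :
    ∫⁻ s, (if |t - s| ≤ r then 0 else ENNReal.ofReal (|t - s| ^ (-(2 / q)))) ^ q =
      ENNReal.ofReal (2 * r⁻¹) := by
  rw [lintegral_sub_left_eq_self
    (fun u : ℝ => (if |u| ≤ r then 0 else ENNReal.ofReal (|u| ^ (-(2 / q)))) ^ q) t,
    lintegral_abs_eq fun v => (if v ≤ r then 0 else ENNReal.ofReal (v ^ (-(2 / q)))) ^ q,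
    ENNReal.ofReal_mul zero_le_two]
  have e : ∀ v ∈ Set.Ioi (0 : ℝ), (if v ≤ r then 0 else ENNReal.ofReal (v ^ (-(2 / q)))) ^ q =
      (Set.Ioi r).indicator (fun v => ENNReal.ofReal (v ^ (-2 : ℝ))) v := fun v hv => by
    have hv0 : (0 : ℝ) < v := hv
    by_cases h : v ≤ r
    · simp [Set.indicator, h, ENNReal.zero_rpow_of_pos hq, not_lt.2 h]
    · rw [if_neg h, Set.indicator_of_mem (by simpa using h),
        ENNReal.ofReal_rpow_of_nonneg (by positivity) hq.le, ← Real.rpow_mul hv0.le]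
      congr 2
      field_simp
  rw [setLIntegral_congr_fun measurableSet_Ioi e, lintegral_indicator measurableSet_Ioi,
    Measure.restrict_restrict measurableSet_Ioi,
    Set.inter_eq_left.2 (Set.Ioi_subset_Ioi hr.le), lintegral_Ioi_rpow' (by norm_num) hr,
    ENNReal.ofReal_ofNat]
  congr 2
  norm_num [Real.rpow_neg_one]

lemma hls_inner {q : ℝ} (hq : 2 < q) {a : ℝ → ℝ} (ha : Measurable a)
    {N : ℝ} (hN : 0 < N)
    (haN : ∫⁻ t, ENNReal.ofReal (a t) ^ (q / (q - 1)) = ENNReal.ofReal N) (t : ℝ) (ht : 0 < a t) :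
    ∫⁻ s, (if a s ≤ a t then ENNReal.ofReal (|t - s| ^ (-(2 / q))) * ENNReal.ofReal (a s) else 0) ≤
      ENNReal.ofReal ((2 / (1 - 2 / q) + 2 ^ (1 / q)) * (N ^ (1 - 2 / q) * a t ^ (1 / (q - 1)))) := by
  set h := a t with hh
  set p := q / (q - 1) with hp
  have hq0 : q ≠ 0 := by linarith
  have hq1 : q - 1 ≠ 0 := by linarith
  have hγ : 2 / q < 1 := by rw [div_lt_one (by linarith)]; exact hq
  set r := N / h ^ p with hr
  have hr0 : 0 < r := by positivity
  have hconj : Real.HolderConjugate q p := Real.HolderConjugate.conjExponent (by linarith)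
  have e : ∀ s, (if a s ≤ h then ENNReal.ofReal (|t - s| ^ (-(2 / q))) * ENNReal.ofReal (a s)
      else 0) ≤ (if |t - s| ≤ r then ENNReal.ofReal (|t - s| ^ (-(2 / q))) else 0) *
        ENNReal.ofReal h +
      (if |t - s| ≤ r then 0 else ENNReal.ofReal (|t - s| ^ (-(2 / q)))) * ENNReal.ofReal (a s) := by
    intro s
    by_cases h1 : a s ≤ h <;> by_cases h2 : |t - s| ≤ r <;> simp only [h1, h2, if_true, if_false]
    · simp only [zero_mul, add_zero]
      gcongr
    · simp
    · simp
    · simp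
  have hm1 : Measurable fun s => (if |t - s| ≤ r then ENNReal.ofReal (|t - s| ^ (-(2 / q))) else 0) :=
    Measurable.ite (measurableSet_le (by fun_prop) (by fun_prop)) (by fun_prop) (by fun_prop)
  have hm2 : Measurable fun s => (if |t - s| ≤ r then 0 else ENNReal.ofReal (|t - s| ^ (-(2 / q)))) :=
    Measurable.ite (measurableSet_le (by fun_prop) (by fun_prop)) (by fun_prop) (by fun_prop)
  have hnear : r ^ (1 - 2 / q) * h = N ^ (1 - 2 / q) * h ^ (1 / (q - 1)) := by
    rw [hr, Real.div_rpow hN.le (by positivity), ← Real.rpow_mul ht.le, div_mul_eq_mul_div,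
      mul_div_assoc]
    congr 1
    nth_rewrite 1 [← Real.rpow_one h]
    rw [← Real.rpow_sub ht]
    congr 1
    rw [hp]
    field_simp
    ring
  have hfar : (2 * r⁻¹) ^ (1 / q) * N ^ (1 / p) =
      2 ^ (1 / q) * (N ^ (1 - 2 / q) * h ^ (1 / (q - 1))) := by
    rw [hr, inv_div, Real.mul_rpow zero_le_two (by positivity),
      Real.div_rpow (by positivity) hN.le, ← Real.rpow_mul ht.le,
      show p * (1 / q) = 1 / (q - 1) by rw [hp]; field_simp,
      show 1 - 2 / q = 1 / p - 1 / q by rw [hp]; field_simp; ring, Real.rpow_sub hN]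
    ring
  refine (lintegral_mono e).trans ?_
  rw [lintegral_add_left (hm1.mul_const _), lintegral_mul_const _ hm1, lintegral_near hγ hr0,
    add_mul, ENNReal.ofReal_add (by
      have : 0 < 1 - 2 / q := by linarith
      positivity) (by positivity)]
  refine add_le_add (le_of_eq ?_) ?_
  · rw [← ENNReal.ofReal_mul (by
      have : 0 < 1 - 2 / q := by linarith
      positivity), ← hnear]
    congr 1
    ring
  · have := ENNReal.lintegral_mul_le_Lp_mul_Lq volume hconj hm2.aemeasurable
      (g := fun s => ENNReal.ofReal (a s)) (by fun_prop)
    refine this.trans (le_of_eq ?_)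
    rw [lintegral_far (by linarith) hr0, haN, ENNReal.ofReal_rpow_of_nonneg (by positivity)
      (by have : 0 < q := by linarith
          positivity),
      ENNReal.ofReal_rpow_of_nonneg hN.le (by
        have := hconj.symm.pos
        positivity), ← ENNReal.ofReal_mul (by positivity), hfar]

/-- The Hardy-Littlewood-Sobolev inequality for the quadratic form, in dimension one. -/
lemma hardy_littlewood_sobolev {q : ℝ} (hq : 2 < q) {a : ℝ → ℝ} (ha : Measurable a)
    (ha0 : ∀ t, 0 ≤ a t) :
    ∫⁻ t, ∫⁻ s, ENNReal.ofReal (|t - s| ^ (-(2 / q))) * ENNReal.ofReal (a t) * ENNReal.ofReal (a s) ≤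
      ENNReal.ofReal (2 * (2 / (1 - 2 / q) + 2 ^ (1 / q))) *
        (∫⁻ t, ENNReal.ofReal (a t) ^ (q / (q - 1))) ^ (2 - 2 / q) := by
  have hq0 : 0 < q := by linarith
  have hq1 : 0 < q - 1 := by linarith
  have hγ : 2 / q < 1 := by rw [div_lt_one (by linarith)]; exact hq
  have hγ0 : 0 < 1 - 2 / q := by linarith
  have hp : 0 < q / (q - 1) := by positivity
  set c : ℝ := 2 / (1 - 2 / q) + 2 ^ (1 / q) with hc
  have hc0 : 0 < c := by positivity
  rcases eq_or_ne (∫⁻ t, ENNReal.ofReal (a t) ^ (q / (q - 1))) ∞ with hN | hN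
  · rw [hN, ENNReal.top_rpow_of_pos (by linarith), ENNReal.mul_top]
    · exact le_top
    · simpa using by positivity
  rcases eq_or_ne (∫⁻ t, ENNReal.ofReal (a t) ^ (q / (q - 1))) 0 with hN0 | hN0
  · have h0 : ∀ᵐ t, ENNReal.ofReal (a t) = 0 := by
      have := (lintegral_eq_zero_iff (by fun_prop)).1 hN0
      filter_upwards [this] with t ht
      exact (ENNReal.rpow_eq_zero_iff_of_pos hp).1 ht
    have : ∫⁻ t, ∫⁻ s, ENNReal.ofReal (|t - s| ^ (-(2 / q))) * ENNReal.ofReal (a t) *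
        ENNReal.ofReal (a s) = ∫⁻ t : ℝ, 0 := by
      refine lintegral_congr_ae ?_
      filter_upwards [h0] with t ht
      simp [ht]
    rw [this]
    simp
  obtain ⟨N, hNN, hNe⟩ : ∃ N : ℝ, 0 < N ∧
      ∫⁻ t, ENNReal.ofReal (a t) ^ (q / (q - 1)) = ENNReal.ofReal N :=
    ⟨_, ENNReal.toReal_pos hN0 hN, (ENNReal.ofReal_toReal hN).symm⟩
  set E : ℝ × ℝ → ℝ≥0∞ := fun z => if a z.2 ≤ a z.1 then
    ENNReal.ofReal (|z.1 - z.2| ^ (-(2 / q))) * ENNReal.ofReal (a z.1) * ENNReal.ofReal (a z.2)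
    else 0 with hE
  have hEm : Measurable E :=
    Measurable.ite (measurableSet_le (by fun_prop) (by fun_prop)) (by fun_prop) (by fun_prop)
  have hEi : ∀ t, ∫⁻ s, E (t, s) ≤ ENNReal.ofReal (c * N ^ (1 - 2 / q)) *
      ENNReal.ofReal (a t) ^ (q / (q - 1)) := by
    intro t
    rcases (ha0 t).eq_or_lt with h0 | h0
    · simp [hE, ← h0]
    have : ∀ s, E (t, s) = ENNReal.ofReal (a t) * (if a s ≤ a t then
        ENNReal.ofReal (|t - s| ^ (-(2 / q))) * ENNReal.ofReal (a s) else 0) := fun s => by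
      by_cases h : a s ≤ a t <;> simp only [hE, h, if_true, if_false]
      · ring
      · simp
    simp_rw [this]
    rw [lintegral_const_mul' _ _ ENNReal.ofReal_ne_top]
    refine (mul_le_mul_right (hls_inner hq ha hNN hNe t h0) _).trans (le_of_eq ?_)
    rw [ENNReal.ofReal_rpow_of_nonneg h0.le hp.le, ← ENNReal.ofReal_mul h0.le,
      ← ENNReal.ofReal_mul (by positivity)]
    congr 1
    have : a t ^ (q / (q - 1)) = a t * a t ^ (1 / (q - 1)) := by
      nth_rewrite 2 [← Real.rpow_one (a t)]
      rw [← Real.rpow_add h0]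
      congr 1
      field_simp
      ring
    rw [this]
    ring
  have hEint : ∫⁻ t, ∫⁻ s, E (t, s) ≤ ENNReal.ofReal (c * N ^ (2 - 2 / q)) := by
    refine (lintegral_mono hEi).trans (le_of_eq ?_)
    rw [lintegral_const_mul' _ _ ENNReal.ofReal_ne_top, hNe, ← ENNReal.ofReal_mul (by positivity),
      mul_assoc, ← Real.rpow_add_one hNN.ne']
    congr 3
    ring
  calc _ ≤ ∫⁻ t, ∫⁻ s, (E (t, s) + E (s, t)) := by
        refine lintegral_mono fun t => lintegral_mono fun s => ?_
        rcases le_total (a s) (a t) with h | h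
        · simp only [hE, h, if_true]
          exact le_self_add
        · simp only [hE, h, if_true]
          refine le_trans (le_of_eq ?_) le_add_self
          rw [abs_sub_comm, mul_right_comm]
    _ = (∫⁻ t, ∫⁻ s, E (t, s)) + ∫⁻ t, ∫⁻ s, E (s, t) := by
        rw [← lintegral_add_left hEm.lintegral_prod_right']
        refine lintegral_congr fun t => ?_
        rw [lintegral_add_left (by fun_prop)]
    _ = 2 * ∫⁻ t, ∫⁻ s, E (t, s) := by
        rw [two_mul]
        congr 1
        exact lintegral_lintegral_swap (f := fun t s => E (s, t))
          (hEm.comp measurable_swap).aemeasurable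
    _ ≤ 2 * ENNReal.ofReal (c * N ^ (2 - 2 / q)) := by gcongr
    _ = _ := by
        rw [hNe, ENNReal.ofReal_rpow_of_nonneg hNN.le (by linarith),
          ← ENNReal.ofReal_mul (by positivity), mul_assoc 2, ENNReal.ofReal_mul zero_le_two,
          ENNReal.ofReal_ofNat]

/-- The `T T*` expansion of an `L²` norm. -/
lemma lintegral_enorm_sq_integral_le {α : Type*} [MeasurableSpace α] {m : Measure α}
    [IsFiniteMeasure m] {u : α → ℝ → ℂ} {w : ℝ → ℝ}
    (hu : StronglyMeasurable (Function.uncurry u)) (hw : Integrable w)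
    (hle : ∀ z t, ‖u z t‖ ≤ w t) :
    ∫⁻ z, ‖∫ t, u z t‖ₑ ^ 2 ∂m ≤ ∫⁻ t, ∫⁻ s, ‖∫ z, u z t * conj (u z s) ∂m‖ₑ := by
  have hI : StronglyMeasurable fun z => ∫ t, u z t := hu.integral_prod_right
  have hbd : ∀ z, ‖∫ t, u z t‖ ≤ ∫ t, w t := fun z =>
    norm_integral_le_of_norm_le hw (Filter.Eventually.of_forall (hle z))
  have hsq : Integrable (fun z => ‖∫ t, u z t‖ ^ 2) m := by
    refine Integrable.of_bound (hI.norm.pow 2).aestronglyMeasurable ((∫ t, w t) ^ 2)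
      (Filter.Eventually.of_forall fun z => ?_)
    rw [Real.norm_of_nonneg (by positivity)]
    exact pow_le_pow_left₀ (norm_nonneg _) (hbd z) 2
  have e1 : ∫⁻ z, ‖∫ t, u z t‖ₑ ^ 2 ∂m = ‖∫ z, (∫ p : ℝ × ℝ, u z p.1 * conj (u z p.2)) ∂m‖ₑ := by
    have : ∀ z, ∫ p : ℝ × ℝ, u z p.1 * conj (u z p.2) = ((‖∫ t, u z t‖ ^ 2 : ℝ) : ℂ) := fun z => by
      rw [Measure.volume_eq_prod, integral_prod_mul (u z) (fun s => conj (u z s)), integral_conj,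
        Complex.mul_conj, Complex.normSq_eq_norm_sq]
    simp_rw [this]
    rw [integral_complex_ofReal, ← ofReal_norm, Complex.norm_real, Real.norm_of_nonneg
      (integral_nonneg fun z => by positivity), ofReal_integral_eq_lintegral_ofReal hsq
      (Filter.Eventually.of_forall fun z => by positivity)]
    refine lintegral_congr fun z => ?_
    rw [ENNReal.ofReal_pow (norm_nonneg _), ofReal_norm]
  have hint : Integrable (Function.uncurry fun (z : α) (p : ℝ × ℝ) => u z p.1 * conj (u z p.2))
      (m.prod volume) := by
    have h1 : Integrable (fun y : α × (ℝ × ℝ) => w y.2.1 * w y.2.2) (m.prod volume) :=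
      (hw.mul_prod hw).comp_snd m
    refine h1.mono' ?_ (Filter.Eventually.of_forall fun y => ?_)
    · have a1 : StronglyMeasurable fun y : α × (ℝ × ℝ) => u y.1 y.2.1 :=
        hu.comp_measurable (g := fun y : α × (ℝ × ℝ) => (y.1, y.2.1)) (by fun_prop)
      have a2 : StronglyMeasurable fun y : α × (ℝ × ℝ) => u y.1 y.2.2 :=
        hu.comp_measurable (g := fun y : α × (ℝ × ℝ) => (y.1, y.2.2)) (by fun_prop)
      exact (a1.mul (RCLike.continuous_conj.comp_stronglyMeasurable a2)).aestronglyMeasurable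
    · simp only [Function.uncurry, norm_mul, RCLike.norm_conj]
      exact mul_le_mul (hle _ _) (hle _ _) (norm_nonneg _) ((norm_nonneg _).trans (hle y.1 _))
  rw [e1, integral_integral_swap hint]
  refine (enorm_integral_le_lintegral_enorm _).trans ?_
  rw [Measure.volume_eq_prod]
  exact lintegral_prod_le _

lemma norm_integral_cexp_le {ρ u θ : ℝ} (hρ : 0 < ρ) (hu : u ≠ 0) (h0 : 0 ≤ θ) (h1 : θ ≤ 1) :
    ‖∫ σ in (-ρ)..ρ, Complex.exp (Complex.I * ((u * σ : ℝ) : ℂ))‖ ≤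
      2 * ρ ^ θ * |u| ^ (θ - 1) := by
  set k := ‖∫ σ in (-ρ)..ρ, Complex.exp (Complex.I * ((u * σ : ℝ) : ℂ))‖ with hk
  have hk0 : 0 ≤ k := norm_nonneg _
  have hu' : 0 < |u| := abs_pos.2 hu
  have b1 : k ≤ 2 * ρ := by
    have := intervalIntegral.norm_integral_le_of_norm_le_const (a := -ρ) (b := ρ) (C := 1)
      (f := fun σ => Complex.exp (Complex.I * ((u * σ : ℝ) : ℂ)))
      (fun σ _ => (norm_cexp_I _).le)
    rw [show ρ - -ρ = 2 * ρ by ring, abs_of_pos (by positivity), one_mul] at this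
    exact this
  have b2 : k ≤ 2 / |u| := by
    have hc : Complex.I * u ≠ 0 := mul_ne_zero Complex.I_ne_zero (by exact_mod_cast hu)
    have e := integral_exp_mul_complex (a := -ρ) (b := ρ) hc
    have e' : ∫ σ in (-ρ)..ρ, Complex.exp (Complex.I * ((u * σ : ℝ) : ℂ)) =
        (Complex.exp (Complex.I * u * ρ) - Complex.exp (Complex.I * u * (-ρ : ℝ))) /
          (Complex.I * u) := by
      rw [← e]
      refine intervalIntegral.integral_congr fun σ _ => ?_
      simp only [Complex.ofReal_mul, mul_assoc]
    rw [hk, e', norm_div, norm_mul, Complex.norm_I, one_mul, Complex.norm_real, Real.norm_eq_abs]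
    gcongr
    refine (norm_sub_le _ _).trans ?_
    have n1 := norm_cexp_I (u * ρ)
    have n2 := norm_cexp_I (u * -ρ)
    rw [Complex.ofReal_mul, ← mul_assoc] at n1 n2
    rw [n1, n2]
    norm_num
  calc k = k ^ θ * k ^ (1 - θ) := by
        rcases hk0.eq_or_lt with h | h
        · rw [← h]
          rcases h0.eq_or_lt with h' | h'
          · rw [← h']; simp
          · rw [Real.zero_rpow h'.ne', zero_mul]
        · rw [← Real.rpow_add h]; simp
    _ ≤ (2 * ρ) ^ θ * (2 / |u|) ^ (1 - θ) := by
        gcongr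
    _ = 2 * ρ ^ θ * |u| ^ (θ - 1) := by
        rw [Real.mul_rpow zero_le_two hρ.le, Real.div_rpow zero_le_two hu'.le,
          show θ - 1 = -(1 - θ) by ring, Real.rpow_neg hu'.le]
        have : (2 : ℝ) ^ θ * 2 ^ (1 - θ) = 2 := by
          rw [← Real.rpow_add two_pos]; simp
        calc _ = ((2 : ℝ) ^ θ * 2 ^ (1 - θ)) * ρ ^ θ * (|u| ^ (1 - θ))⁻¹ := by ring
          _ = _ := by rw [this]

lemma lintegral_enorm_rpow_eq {p : ℝ} (hp : 0 ≤ p) {g : ℝ → ℂ}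
    (hgp : Integrable fun x => ‖g x‖ ^ p) :
    ENNReal.ofReal (∫ x, ‖g x‖ ^ p) = ∫⁻ x, ‖g x‖ₑ ^ p := by
  rw [ofReal_integral_eq_lintegral_ofReal hgp (Filter.Eventually.of_forall fun x => by positivity)]
  refine lintegral_congr fun x => ?_
  rw [← ENNReal.ofReal_rpow_of_nonneg (norm_nonneg _) hp, ofReal_norm]

/-- Parseval for the truncated group. -/
lemma integral_truncated_mul_conj (ν μ R t : ℝ) {f g : ℝ → ℂ} (hf : Integrable f)
    (hg : Integrable g) :
    ∫ ξ in (-R)..R, Complex.exp (Complex.I * ((t * phase ν μ ξ : ℝ) : ℂ)) * FT f ξ *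
      conj (FT g ξ) = ∫ y, truncGrp ν μ R t f y * conj (g y) := by
  have hph := continuous_phase ν μ
  have hFT := continuous_FT hf
  have e1 : ∫ ξ in (-R)..R, Complex.exp (Complex.I * ((t * phase ν μ ξ : ℝ) : ℂ)) * FT f ξ *
      conj (FT g ξ) = ∫ ξ in (-R)..R, ∫ y, Complex.exp (Complex.I *
        ((y * ξ + t * phase ν μ ξ : ℝ) : ℂ)) * FT f ξ * conj (g y) := by
    refine intervalIntegral.integral_congr fun ξ _ => ?_
    rw [show FT g ξ = ∫ x : ℝ, Complex.exp (-(Complex.I * ξ * x)) * g x from rfl, ← integral_conj,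
      ← integral_const_mul]
    congr 1 with y
    rw [map_mul, ← Complex.exp_conj]
    simp only [map_neg, map_mul, Complex.conj_I, Complex.conj_ofReal]
    rw [mul_comm y ξ, Complex.ofReal_add, mul_add, Complex.exp_add]
    push_cast
    ring_nf
  have : IsFiniteMeasure (volume.restrict (Set.uIoc (-R) R)) :=
    ⟨by
      rw [Measure.restrict_apply_univ, Set.uIoc, Real.volume_Ioc]
      exact ENNReal.ofReal_lt_top⟩
  have hint : Integrable (Function.uncurry fun (ξ y : ℝ) => Complex.exp (Complex.I *
        ((y * ξ + t * phase ν μ ξ : ℝ) : ℂ)) * FT f ξ * conj (g y))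
      ((volume.restrict (Set.uIoc (-R) R)).prod volume) := by
    have h3 : Integrable (fun z : ℝ × ℝ => conj (g z.2))
        ((volume.restrict (Set.uIoc (-R) R)).prod volume) :=
      (Complex.conjLIE.toContinuousLinearEquiv.toContinuousLinearMap.integrable_comp hg).comp_snd _
    refine h3.bdd_mul (c := ∫ x, ‖f x‖) (Continuous.aestronglyMeasurable (by fun_prop))
      (Filter.Eventually.of_forall fun z => ?_)
    rw [norm_mul, norm_cexp_I, one_mul]
    exact norm_FT_le f _
  rw [e1, intervalIntegral_integral_swap hint]
  refine integral_congr_ae (Filter.Eventually.of_forall fun y => ?_)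
  simp only
  rw [intervalIntegral.integral_mul_const, truncGrp]

/-- The dispersive estimate `L^p → L^q` for the truncated group, in bilinear form. -/
lemma enorm_integral_truncated_mul_conj_le (ν : ℝ) {μ : ℝ} (hμ : μ ≠ 0) {q : ℝ} (hq : 2 < q) :
    ∃ C : ℝ, 0 < C ∧ ∀ (R t : ℝ) (f g : ℝ → ℂ), 0 ≤ R → t ≠ 0 → Measurable f → Integrable f →
      MemLp f 2 → (Integrable fun x => ‖f x‖ ^ (q / (q - 1))) → Measurable g → Integrable g →
      ‖∫ ξ in (-R)..R, Complex.exp (Complex.I * ((t * phase ν μ ξ : ℝ) : ℂ)) * FT f ξ *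
        conj (FT g ξ)‖ₑ ≤ ENNReal.ofReal (C * |t| ^ (-((1 / 3) * (1 - 2 / q)))) *
        (∫⁻ x, ‖f x‖ₑ ^ (q / (q - 1))) ^ ((q - 1) / q) *
        (∫⁻ x, ‖g x‖ₑ ^ (q / (q - 1))) ^ ((q - 1) / q) := by
  have hq0 : 0 < q := by linarith
  have hq1 : 0 < q - 1 := by linarith
  have hq2 : 0 < q - 2 := by linarith
  set B : ℝ := 24 * |μ| ^ (-(1 / 3) : ℝ) with hB
  have hB0 : 0 < B := by
    have := abs_pos.2 hμ
    positivity
  set D : ℝ≥0∞ := ENNReal.ofReal (2 * π) ^ 2 with hD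
  have hDe : D = ENNReal.ofReal ((2 * π) ^ 2) := by
    rw [hD, ENNReal.ofReal_pow (by positivity)]
  have hpi := Real.pi_pos
  refine ⟨(4 * q / (q - 2) * (2 * π) ^ 2) ^ (1 / q) * (2 * B) ^ ((q - 2) / q), by positivity, ?_⟩
  intro R t f g hR ht hfm hf hf2 hfp hgm hg
  have ht0 := abs_pos.2 ht
  have hA : 0 < B * |t| ^ (-(1 / 3) : ℝ) := by positivity
  have hmain := lintegral_rpow_le_of_interpolation (T := truncGrp ν μ R t) (D := D) hA
    (fun f g hf hg x => truncGrp_add ν μ R t hf hg x)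
    (fun g hg => (continuous_truncGrp ν μ t hR hg).measurable)
    (fun g hg x => norm_truncGrp_le ν hμ ht hR hg x)
    (fun g hg hg2 => lintegral_truncGrp_sq_le ν μ t hR hg hg2) hq hfm hf hf2 hfp
  rw [lintegral_enorm_rpow_eq (by positivity) hfp] at hmain
  have hconj : Real.HolderConjugate q (q / (q - 1)) :=
    Real.HolderConjugate.conjExponent (by linarith)
  rw [integral_truncated_mul_conj ν μ R t hf hg]
  refine (enorm_integral_le_lintegral_enorm _).trans ?_
  have hH := ENNReal.lintegral_mul_le_Lp_mul_Lq volume hconj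
    (f := fun y => ‖truncGrp ν μ R t f y‖ₑ) (g := fun y => ‖g y‖ₑ)
    (continuous_truncGrp ν μ t hR hf).measurable.enorm.aemeasurable hgm.enorm.aemeasurable
  have e : ∀ y, ‖truncGrp ν μ R t f y * conj (g y)‖ₑ =
      ((fun y => ‖truncGrp ν μ R t f y‖ₑ) * fun y => ‖g y‖ₑ) y := fun y => by
    rw [enorm_mul, Pi.mul_apply, RCLike.enorm_conj]
  simp_rw [e]
  refine hH.trans ?_
  rw [show 1 / (q / (q - 1)) = (q - 1) / q by rw [one_div, inv_div]]
  refine mul_le_mul_left ?_ _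
  refine (ENNReal.rpow_le_rpow hmain (by positivity : 0 ≤ 1 / q)).trans (le_of_eq ?_)
  rw [ENNReal.mul_rpow_of_nonneg _ _ (by positivity), ← ENNReal.rpow_mul,
    show (q - 1) * (1 / q) = (q - 1) / q by ring]
  congr 1
  rw [hDe, ← ENNReal.ofReal_mul (by positivity), ENNReal.ofReal_rpow_of_nonneg (by positivity)
    (by positivity)]
  congr 1
  have e2 : 4 * q / (q - 2) * (2 * (B * |t| ^ (-(1 / 3) : ℝ))) ^ (q - 2) * (2 * π) ^ 2 =
      4 * q / (q - 2) * (2 * π) ^ 2 * ((2 * B) ^ (q - 2) * (|t| ^ (-(1 / 3) : ℝ)) ^ (q - 2)) := by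
    rw [← mul_assoc 2 B, Real.mul_rpow (by positivity) (by positivity)]
    ring
  rw [e2, Real.mul_rpow (x := 4 * q / (q - 2) * (2 * π) ^ 2) (by positivity) (by positivity),
    Real.mul_rpow (x := (2 * B) ^ (q - 2)) (by positivity) (by positivity), ← Real.rpow_mul (by positivity),
    ← Real.rpow_mul ht0.le, ← Real.rpow_mul ht0.le,
    show (q - 2) * (1 / q) = (q - 2) / q by ring,
    show -(1 / 3) * (q - 2) * (1 / q) = -((1 / 3) * (1 - 2 / q)) by field_simp]
  ring

lemma integrable_norm_rpow_of_decay {f : ℝ → ℂ} (hf : Continuous f) {M : ℝ}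
    (hM : ∀ x, ‖f x‖ ≤ M * (1 + x ^ 2)⁻¹) {p : ℝ} (hp : 1 ≤ p) :
    Integrable fun x => ‖f x‖ ^ p := by
  have hM0 : 0 ≤ M := by
    have := (norm_nonneg _).trans (hM 0)
    simpa using this
  refine (integrable_inv_one_add_sq.const_mul (M ^ p)).mono' ?_
    (Filter.Eventually.of_forall fun x => ?_)
  · exact (hf.norm.rpow_const fun x => Or.inr (by linarith)).aestronglyMeasurable
  · have h1 : (1 : ℝ) ≤ 1 + x ^ 2 := by nlinarith [sq_nonneg x]
    rw [Real.norm_of_nonneg (by positivity)]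
    calc ‖f x‖ ^ p ≤ (M * (1 + x ^ 2)⁻¹) ^ p := by
          gcongr
          exact hM x
      _ = M ^ p * ((1 + x ^ 2)⁻¹) ^ p := Real.mul_rpow hM0 (by positivity)
      _ ≤ M ^ p * (1 + x ^ 2)⁻¹ := by
          gcongr
          nth_rewrite 2 [← Real.rpow_one (1 + x ^ 2)⁻¹]
          exact Real.rpow_le_rpow_of_exponent_ge (by positivity) (inv_le_one_of_one_le₀ h1) hp

lemma integrable_of_decay {f : ℝ → ℂ} (hf : Continuous f) {M : ℝ}
    (hM : ∀ x, ‖f x‖ ≤ M * (1 + x ^ 2)⁻¹) : Integrable f :=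
  (integrable_inv_one_add_sq.const_mul M).mono' hf.aestronglyMeasurable
    (Filter.Eventually.of_forall hM)

lemma memLp_two_of_decay {f : ℝ → ℂ} (hf : Continuous f) {M : ℝ}
    (hM : ∀ x, ‖f x‖ ≤ M * (1 + x ^ 2)⁻¹) : MemLp f 2 := by
  rw [memLp_two_iff_integrable_sq_norm hf.aestronglyMeasurable]
  simpa using integrable_norm_rpow_of_decay hf hM (p := 2) (by norm_num)

lemma decay_slice {G : ℝ → ℝ → ℂ} {M : ℝ}
    (hM : ∀ x t, ‖G x t‖ ≤ M * ((1 + x ^ 2)⁻¹ * (1 + t ^ 2)⁻¹)) (t : ℝ) :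
    ∀ x, ‖G x t‖ ≤ (M * (1 + t ^ 2)⁻¹) * (1 + x ^ 2)⁻¹ := fun x =>
  (hM x t).trans (le_of_eq (by ring))

lemma decay_const_nonneg {G : ℝ → ℝ → ℂ} {M : ℝ}
    (hM : ∀ x t, ‖G x t‖ ≤ M * ((1 + x ^ 2)⁻¹ * (1 + t ^ 2)⁻¹)) : 0 ≤ M := by
  have := (norm_nonneg _).trans (hM 0 0)
  simpa using this

lemma continuous_FT_slice {G : ℝ → ℝ → ℂ} (hG : Continuous (Function.uncurry G)) {M : ℝ}
    (hM : ∀ x t, ‖G x t‖ ≤ M * ((1 + x ^ 2)⁻¹ * (1 + t ^ 2)⁻¹)) :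
    Continuous fun z : ℝ × ℝ => FT (fun x => G x z.2) z.1 := by
  have hM0 := decay_const_nonneg hM
  unfold FT
  refine continuous_of_dominated (bound := fun x => M * (1 + x ^ 2)⁻¹) (fun z => ?_) (fun z => ?_)
    (integrable_inv_one_add_sq.const_mul M) (Filter.Eventually.of_forall fun x => ?_)
  · have : Continuous fun x => G x z.2 := hG.comp (f := fun x => (x, z.2)) (by fun_prop)
    exact Continuous.aestronglyMeasurable (by fun_prop)
  · refine Filter.Eventually.of_forall fun x => ?_
    have := norm_cexp_I (-(z.1 * x))
    push_cast at this
    rw [norm_mul, show -(Complex.I * z.1 * x) = Complex.I * -(z.1 * x) by ring, this, one_mul]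
    refine (hM x z.2).trans ?_
    gcongr
    refine mul_le_of_le_one_right (by positivity) (inv_le_one_of_one_le₀ ?_)
    nlinarith [sq_nonneg z.2]
  · have : Continuous fun z : ℝ × ℝ => G x z.2 := hG.comp (f := fun z : ℝ × ℝ => (x, z.2)) (by fun_prop)
    fun_prop

lemma integrable_prod_of_decay {G : ℝ → ℝ → ℂ} (hG : Continuous (Function.uncurry G)) {M : ℝ}
    (hM : ∀ x t, ‖G x t‖ ≤ M * ((1 + x ^ 2)⁻¹ * (1 + t ^ 2)⁻¹)) :
    Integrable (Function.uncurry G) (volume.prod volume) :=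
  ((integrable_inv_one_add_sq.mul_prod integrable_inv_one_add_sq).const_mul M).mono'
    hG.aestronglyMeasurable (Filter.Eventually.of_forall fun z => hM z.1 z.2)

lemma FT2_eq_integral_FT {G : ℝ → ℝ → ℂ} (hG : Continuous (Function.uncurry G)) {M : ℝ}
    (hM : ∀ x t, ‖G x t‖ ≤ M * ((1 + x ^ 2)⁻¹ * (1 + t ^ 2)⁻¹)) (ξ τ : ℝ) :
    FT2 G ξ τ = ∫ t, Complex.exp (Complex.I * ((-(t * τ) : ℝ) : ℂ)) * FT (fun x => G x t) ξ := by
  have hint : Integrable (Function.uncurry fun x t : ℝ =>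
      Complex.exp (-(Complex.I * (ξ * x + τ * t))) * G x t) (volume.prod volume) := by
    refine (integrable_prod_of_decay hG hM).bdd_mul (c := 1)
      (f := fun z : ℝ × ℝ => Complex.exp (-(Complex.I * (ξ * z.1 + τ * z.2))))
      (Continuous.aestronglyMeasurable (by fun_prop))
      (Filter.Eventually.of_forall fun z => ?_)
    have := norm_cexp_I (-(ξ * z.1 + τ * z.2))
    push_cast at this
    rw [show -(Complex.I * (ξ * z.1 + τ * z.2)) = Complex.I * -(ξ * z.1 + τ * z.2) by ring, this]
  rw [FT2, integral_integral_swap hint]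
  refine integral_congr_ae (Filter.Eventually.of_forall fun t => ?_)
  simp only [FT]
  rw [← integral_const_mul]
  congr 1 with x
  rw [← mul_assoc, ← Complex.exp_add]
  congr 2
  push_cast
  ring

/-- Restriction estimate on the `ρ`-neighbourhood of the dispersion curve. -/
lemma lintegral_FT2_strip_le (ν : ℝ) {μ : ℝ} (hμ : μ ≠ 0) {q : ℝ} (hq : 2 < q) (hq8 : q ≤ 8) :
    ∃ C : ℝ, 0 < C ∧ ∀ (G : ℝ → ℝ → ℂ) (M R ρ : ℝ), Continuous (Function.uncurry G) →
      (∀ x t, ‖G x t‖ ≤ M * ((1 + x ^ 2)⁻¹ * (1 + t ^ 2)⁻¹)) → 0 ≤ R → 0 < ρ →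
      ∫⁻ ξ in Set.Ioc (-R) R, ∫⁻ σ in Set.Ioc (-ρ) ρ, ‖FT2 G ξ (phase ν μ ξ + σ)‖ₑ ^ 2 ≤
        ENNReal.ofReal (C * ρ ^ (4 * (q - 2) / (3 * q))) *
        (∫⁻ t, ∫⁻ x, ‖G x t‖ₑ ^ (q / (q - 1))) ^ (2 - 2 / q) := by
  have hq0 : 0 < q := by linarith
  have hq1 : 0 < q - 1 := by linarith
  have hq2 : 0 < q - 2 := by linarith
  have hγ0 : 0 < 1 - 2 / q := by
    rw [sub_pos, div_lt_one hq0]; exact hq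
  have hp1 : 1 ≤ q / (q - 1) := by
    rw [le_div_iff₀ hq1]; linarith
  obtain ⟨C, hC0, hC⟩ := enorm_integral_truncated_mul_conj_le ν hμ hq
  set c : ℝ := 2 * (2 / (1 - 2 / q) + 2 ^ (1 / q)) with hc
  have hc0 : 0 < c := by positivity
  refine ⟨2 * C * c, by positivity, ?_⟩
  intro G M R ρ hG hM hR hρ
  set θ := 4 * (q - 2) / (3 * q) with hθ
  have hθ0 : 0 ≤ θ := by positivity
  have hθ1 : θ ≤ 1 := by
    rw [hθ, div_le_one (by positivity)]; linarith
  have hM0 := decay_const_nonneg hM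
  have hsl : ∀ t, Continuous fun x => G x t := fun t =>
    hG.comp (f := fun x => (x, t)) (by fun_prop)
  have hint : ∀ t, Integrable fun x => G x t := fun t =>
    integrable_of_decay (hsl t) (decay_slice hM t)
  have hintp : ∀ t, Integrable fun x => ‖G x t‖ ^ (q / (q - 1)) := fun t =>
    integrable_norm_rpow_of_decay (hsl t) (decay_slice hM t) hp1
  have hH := continuous_FT_slice hG hM
  have hph := continuous_phase ν μ
  set W := ∫ x : ℝ, (1 + x ^ 2)⁻¹ with hW
  have hHb : ∀ ξ t, ‖FT (fun x => G x t) ξ‖ ≤ M * W * (1 + t ^ 2)⁻¹ := fun ξ t => by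
    refine (norm_FT_le _ _).trans ?_
    calc ∫ x, ‖G x t‖ ≤ ∫ x : ℝ, (M * (1 + t ^ 2)⁻¹) * (1 + x ^ 2)⁻¹ :=
          integral_mono (hint t).norm (integrable_inv_one_add_sq.const_mul _) (decay_slice hM t)
      _ = M * W * (1 + t ^ 2)⁻¹ := by
          rw [integral_const_mul]; ring
  set A : ℝ → ℝ≥0∞ := fun t => (∫⁻ x, ‖G x t‖ₑ ^ (q / (q - 1))) ^ ((q - 1) / q) with hA
  have hAtop : ∀ t, A t ≠ ∞ := fun t => by
    simp only [hA]
    rw [← lintegral_enorm_rpow_eq (by positivity) (hintp t)]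
    exact ENNReal.rpow_ne_top_of_nonneg (by positivity) ENNReal.ofReal_ne_top
  have hAm : Measurable A := by
    refine Measurable.pow_const ?_ _
    exact Measurable.lintegral_prod_left' (f := fun z : ℝ × ℝ => ‖G z.1 z.2‖ₑ ^ (q / (q - 1)))
      (hG.measurable.enorm.pow_const _)
  set m1 := (volume : Measure ℝ).restrict (Set.Ioc (-R) R) with hm1
  set m2 := (volume : Measure ℝ).restrict (Set.Ioc (-ρ) ρ) with hm2
  set u : ℝ × ℝ → ℝ → ℂ := fun z t =>
    Complex.exp (Complex.I * ((-(t * (phase ν μ z.1 + z.2)) : ℝ) : ℂ)) *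
      FT (fun x => G x t) z.1 with hu
  have huc : Continuous (Function.uncurry u) := by
    have : Continuous fun y : (ℝ × ℝ) × ℝ => FT (fun x => G x y.2) y.1.1 :=
      hH.comp (f := fun y : (ℝ × ℝ) × ℝ => (y.1.1, y.2)) (by fun_prop)
    simp only [hu, Function.uncurry_def]
    fun_prop
  have hTT := lintegral_enorm_sq_integral_le (m := m1.prod m2) (u := u)
    (w := fun t => M * W * (1 + t ^ 2)⁻¹) huc.stronglyMeasurable
    (integrable_inv_one_add_sq.const_mul _) (fun z t => by
      simp only [hu]
      rw [norm_mul, norm_cexp_I, one_mul]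
      exact hHb _ _)
  have hLHS : ∫⁻ ξ in Set.Ioc (-R) R, ∫⁻ σ in Set.Ioc (-ρ) ρ, ‖FT2 G ξ (phase ν μ ξ + σ)‖ₑ ^ 2 =
      ∫⁻ z, ‖∫ t, u z t‖ₑ ^ 2 ∂(m1.prod m2) := by
    have hmeas : Measurable fun z => ‖∫ t, u z t‖ₑ ^ 2 :=
      (huc.stronglyMeasurable.integral_prod_right).measurable.enorm.pow_const 2
    rw [lintegral_prod _ hmeas.aemeasurable]
    refine lintegral_congr fun ξ => lintegral_congr fun σ => ?_
    rw [FT2_eq_integral_FT hG hM]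
  have hker : ∀ t s, t ≠ s → ‖∫ z, u z t * conj (u z s) ∂(m1.prod m2)‖ₑ ≤
      ENNReal.ofReal (2 * C * ρ ^ θ) * (ENNReal.ofReal (|t - s| ^ (-(2 / q))) *
        ENNReal.ofReal (A t).toReal * ENNReal.ofReal (A s).toReal) := by
    intro t s hts
    have hst : s - t ≠ 0 := sub_ne_zero.2 hts.symm
    have hst' : 0 < |s - t| := abs_pos.2 hst
    have e : ∀ z, u z t * conj (u z s) =
        (Complex.exp (Complex.I * (((s - t) * phase ν μ z.1 : ℝ) : ℂ)) * FT (fun x => G x t) z.1 *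
          conj (FT (fun x => G x s) z.1)) *
        Complex.exp (Complex.I * (((s - t) * z.2 : ℝ) : ℂ)) := fun z => by
      have e3 : Complex.exp (Complex.I * ((-(t * (phase ν μ z.1 + z.2)) : ℝ) : ℂ)) *
          conj (Complex.exp (Complex.I * ((-(s * (phase ν μ z.1 + z.2)) : ℝ) : ℂ))) =
          Complex.exp (Complex.I * (((s - t) * phase ν μ z.1 : ℝ) : ℂ)) *
          Complex.exp (Complex.I * (((s - t) * z.2 : ℝ) : ℂ)) := by
        rw [← Complex.exp_conj, ← Complex.exp_add, ← Complex.exp_add, map_mul, Complex.conj_I,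
          Complex.conj_ofReal]
        congr 1
        push_cast
        ring
      simp only [hu, map_mul]
      linear_combination (FT (fun x => G x t) z.1 * conj (FT (fun x => G x s) z.1)) * e3
    simp_rw [e]
    rw [integral_prod_mul (fun ξ => Complex.exp (Complex.I * (((s - t) * phase ν μ ξ : ℝ) : ℂ)) *
      FT (fun x => G x t) ξ * conj (FT (fun x => G x s) ξ))
      (fun σ => Complex.exp (Complex.I * (((s - t) * σ : ℝ) : ℂ))), hm1, hm2,
      ← intervalIntegral.integral_of_le (by linarith),
      ← intervalIntegral.integral_of_le (by linarith), enorm_mul]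
    have b1 := hC R (s - t) (fun x => G x t) (fun x => G x s) hR hst (hsl t).measurable (hint t)
      (memLp_two_of_decay (hsl t) (decay_slice hM t)) (hintp t) (hsl s).measurable (hint s)
    have b2 : ‖∫ σ in (-ρ)..ρ, Complex.exp (Complex.I * (((s - t) * σ : ℝ) : ℂ))‖ₑ ≤
        ENNReal.ofReal (2 * ρ ^ θ * |s - t| ^ (θ - 1)) := by
      rw [← ofReal_norm]
      exact ENNReal.ofReal_le_ofReal (norm_integral_cexp_le hρ hst hθ0 hθ1)
    refine (mul_le_mul' b1 b2).trans (le_of_eq ?_)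
    rw [ENNReal.ofReal_toReal (hAtop t), ENNReal.ofReal_toReal (hAtop s)]
    have e4 : ENNReal.ofReal (C * |s - t| ^ (-((1 / 3) * (1 - 2 / q)))) *
        ENNReal.ofReal (2 * ρ ^ θ * |s - t| ^ (θ - 1)) =
        ENNReal.ofReal (2 * C * ρ ^ θ) * ENNReal.ofReal (|t - s| ^ (-(2 / q))) := by
      rw [← ENNReal.ofReal_mul (by positivity), ← ENNReal.ofReal_mul (by positivity)]
      congr 1
      have : -(2 / q) = -((1 / 3) * (1 - 2 / q)) + (θ - 1) := by
        rw [hθ]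
        field_simp
        ring
      rw [abs_sub_comm t s, this, Real.rpow_add hst']
      ring
    calc _ = (ENNReal.ofReal (C * |s - t| ^ (-((1 / 3) * (1 - 2 / q)))) *
        ENNReal.ofReal (2 * ρ ^ θ * |s - t| ^ (θ - 1))) * A t * A s := by
          simp only [hA]; ring
      _ = _ := by rw [e4]; ring
  have hhls := hardy_littlewood_sobolev hq (a := fun t => (A t).toReal) hAm.ennreal_toReal
    (fun t => ENNReal.toReal_nonneg)
  have hAp : ∀ t, ENNReal.ofReal (A t).toReal ^ (q / (q - 1)) = ∫⁻ x, ‖G x t‖ₑ ^ (q / (q - 1)) := by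
    intro t
    rw [ENNReal.ofReal_toReal (hAtop t), ← ENNReal.rpow_mul,
      show (q - 1) / q * (q / (q - 1)) = 1 by field_simp, ENNReal.rpow_one]
  simp_rw [hAp] at hhls
  rw [hLHS]
  calc _ ≤ ∫⁻ t, ∫⁻ s, ENNReal.ofReal (2 * C * ρ ^ θ) * (ENNReal.ofReal (|t - s| ^ (-(2 / q))) *
        ENNReal.ofReal (A t).toReal * ENNReal.ofReal (A s).toReal) := by
        refine hTT.trans (lintegral_mono fun t => lintegral_mono_ae ?_)
        have : ∀ᵐ s : ℝ, s ≠ t := by simp [ae_iff]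
        filter_upwards [this] with s hs
        exact hker t s hs.symm
    _ = ENNReal.ofReal (2 * C * ρ ^ θ) * ∫⁻ t, ∫⁻ s, (ENNReal.ofReal (|t - s| ^ (-(2 / q))) *
        ENNReal.ofReal (A t).toReal * ENNReal.ofReal (A s).toReal) := by
        simp_rw [lintegral_const_mul' _ _ ENNReal.ofReal_ne_top]
    _ ≤ ENNReal.ofReal (2 * C * ρ ^ θ) * (ENNReal.ofReal c *
        (∫⁻ t, ∫⁻ x, ‖G x t‖ₑ ^ (q / (q - 1))) ^ (2 - 2 / q)) := by
        gcongr
    _ = _ := by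
        rw [← mul_assoc, ← ENNReal.ofReal_mul (by positivity)]
        congr 2
        ring

/-- Dyadic majorant of the modulation weight. -/
lemma weight_le_tsum {b : ℝ} (hb : 0 ≤ b) (σ : ℝ) :
    ENNReal.ofReal ((1 + σ ^ 2) ^ (-b)) ≤ ∑' k : ℕ, ENNReal.ofReal (4 ^ b * (2 ^ k) ^ (-(2 * b))) *
      (Set.Ioc (-(2 : ℝ) ^ k) (2 ^ k)).indicator 1 σ := by
  have hex : ∃ k : ℕ, |σ| < 2 ^ k := pow_unbounded_of_one_lt _ (by norm_num)
  set k := Nat.find hex with hk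
  have hk1 : |σ| < 2 ^ k := Nat.find_spec hex
  refine le_trans ?_ (ENNReal.le_tsum k)
  rw [Set.indicator_of_mem (show σ ∈ Set.Ioc (-(2 : ℝ) ^ k) (2 ^ k) from
    ⟨(abs_lt.1 hk1).1, (abs_lt.1 hk1).2.le⟩), Pi.one_apply, mul_one]
  refine ENNReal.ofReal_le_ofReal ?_
  have h4 : (4 : ℝ) ^ b = 2 ^ (2 * b) := by
    rw [Real.rpow_mul zero_le_two]; norm_num
  rcases Nat.eq_zero_or_pos k with h0 | h0
  · rw [h0, pow_zero, Real.one_rpow, mul_one]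
    exact (Real.rpow_le_one_of_one_le_of_nonpos (by nlinarith [sq_nonneg σ]) (by linarith)).trans
      (Real.one_le_rpow (by norm_num) hb)
  · have hk2 : (2 : ℝ) ^ (k - 1) ≤ |σ| := not_lt.1 (Nat.find_min hex (by omega))
    have e : (2 : ℝ) ^ k = 2 * 2 ^ (k - 1) := by
      rw [← pow_succ', Nat.sub_add_cancel h0]
    rw [e, h4, Real.mul_rpow zero_le_two (by positivity), ← mul_assoc,
      ← Real.rpow_add two_pos, add_neg_cancel, Real.rpow_zero, one_mul]
    calc (1 + σ ^ 2) ^ (-b) ≤ (((2 : ℝ) ^ (k - 1)) ^ 2) ^ (-b) := by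
          refine Real.rpow_le_rpow_of_nonpos (by positivity) ?_ (by linarith)
          have := pow_le_pow_left₀ (by positivity) hk2 2
          rw [sq_abs] at this
          linarith
      _ = ((2 : ℝ) ^ (k - 1)) ^ (-(2 * b)) := by
          rw [← Real.rpow_natCast _ 2, ← Real.rpow_mul (by positivity)]
          congr 1
          push_cast
          ring

lemma measurable_FT2_shift (ν μ : ℝ) {G : ℝ → ℝ → ℂ} (hG : Continuous (Function.uncurry G)) {M : ℝ}
    (hM : ∀ x t, ‖G x t‖ ≤ M * ((1 + x ^ 2)⁻¹ * (1 + t ^ 2)⁻¹)) :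
    Measurable fun z : ℝ × ℝ => FT2 G z.1 (phase ν μ z.1 + z.2) := by
  have hph := continuous_phase ν μ
  have hH := continuous_FT_slice hG hM
  simp_rw [FT2_eq_integral_FT hG hM]
  have huc : Continuous (Function.uncurry fun (z : ℝ × ℝ) (t : ℝ) =>
      Complex.exp (Complex.I * ((-(t * (phase ν μ z.1 + z.2)) : ℝ) : ℂ)) *
      FT (fun x => G x t) z.1) := by
    have : Continuous fun y : (ℝ × ℝ) × ℝ => FT (fun x => G x y.2) y.1.1 :=
      hH.comp (f := fun y : (ℝ × ℝ) × ℝ => (y.1.1, y.2)) (by fun_prop)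
    simp only [Function.uncurry_def]
    fun_prop
  exact huc.stronglyMeasurable.integral_prod_right.measurable

/-- The dual estimate `L^p → X_{0,-b}`. -/
lemma lintegral_FT2_weighted_le (ν : ℝ) {μ : ℝ} (hμ : μ ≠ 0) {q : ℝ} (hq : 2 < q) (hq8 : q ≤ 8)
    {b : ℝ} (hb : 2 * (q - 2) / (3 * q) < b) :
    ∃ C : ℝ, 0 < C ∧ ∀ (G : ℝ → ℝ → ℂ) (M : ℝ), Continuous (Function.uncurry G) →
      (∀ x t, ‖G x t‖ ≤ M * ((1 + x ^ 2)⁻¹ * (1 + t ^ 2)⁻¹)) →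
      ∫⁻ ξ, ∫⁻ τ, ‖FT2 G ξ τ‖ₑ ^ 2 * ENNReal.ofReal ((1 + (τ - phase ν μ ξ) ^ 2) ^ (-b)) ≤
        ENNReal.ofReal C * (∫⁻ t, ∫⁻ x, ‖G x t‖ₑ ^ (q / (q - 1))) ^ (2 - 2 / q) := by
  obtain ⟨C, hC0, hC⟩ := lintegral_FT2_strip_le ν hμ hq hq8
  set θ := 4 * (q - 2) / (3 * q) with hθ
  have hθb : θ < 2 * b := by
    have : θ = 2 * (2 * (q - 2) / (3 * q)) := by rw [hθ]; ring
    linarith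
  have hb0 : 0 < b := by
    have : 0 ≤ 2 * (q - 2) / (3 * q) := by
      have : 0 < q - 2 := by linarith
      positivity
    linarith
  set r : ℝ := 2 ^ (θ - 2 * b) with hr
  have hr0 : 0 < r := by positivity
  have hr1 : r < 1 := Real.rpow_lt_one_of_one_lt_of_neg (by norm_num) (by linarith)
  refine ⟨4 ^ b * C * (1 - r)⁻¹, by
    have : 0 < 1 - r := by linarith
    positivity, ?_⟩
  intro G M hG hM
  set N := (∫⁻ t, ∫⁻ x, ‖G x t‖ₑ ^ (q / (q - 1))) ^ (2 - 2 / q) with hN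
  set h : ℝ × ℝ → ℝ≥0∞ := fun z => ‖FT2 G z.1 (phase ν μ z.1 + z.2)‖ₑ ^ 2 with hh
  have hhm : Measurable h := (measurable_FT2_shift ν μ hG hM).enorm.pow_const 2
  have e1 : ∀ ξ, ∫⁻ τ, ‖FT2 G ξ τ‖ₑ ^ 2 * ENNReal.ofReal ((1 + (τ - phase ν μ ξ) ^ 2) ^ (-b)) =
      ∫⁻ σ, h (ξ, σ) * ENNReal.ofReal ((1 + σ ^ 2) ^ (-b)) := fun ξ => by
    rw [← lintegral_add_left_eq_self _ (phase ν μ ξ)]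
    simp [hh]
  simp_rw [e1]
  have hwm : Measurable fun z : ℝ × ℝ => h z * ENNReal.ofReal ((1 + z.2 ^ 2) ^ (-b)) := by
    fun_prop
  have hcover : AECover (volume : Measure ℝ) Filter.atTop fun n : ℕ => Set.Ioc (-(n : ℝ)) n :=
    aecover_Ioc (Filter.tendsto_neg_atTop_atBot.comp tendsto_natCast_atTop_atTop)
      tendsto_natCast_atTop_atTop
  refine le_of_tendsto (hcover.lintegral_tendsto_of_countably_generated
    hwm.lintegral_prod_right'.aemeasurable) (Filter.Eventually.of_forall fun n => ?_)
  set c : ℕ → ℝ≥0∞ := fun k => ENNReal.ofReal (4 ^ b * (2 ^ k) ^ (-(2 * b))) with hc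
  have hmk : ∀ k, Measurable fun z : ℝ × ℝ => c k *
      (Set.univ ×ˢ Set.Ioc (-(2 : ℝ) ^ k) (2 ^ k)).indicator h z := fun k =>
    (hhm.indicator (MeasurableSet.univ.prod measurableSet_Ioc)).const_mul _
  calc ∫⁻ ξ in Set.Ioc (-(n : ℝ)) n, ∫⁻ σ, h (ξ, σ) * ENNReal.ofReal ((1 + σ ^ 2) ^ (-b))
      ≤ ∫⁻ ξ in Set.Ioc (-(n : ℝ)) n, ∫⁻ σ, ∑' k : ℕ, c k *
        (Set.univ ×ˢ Set.Ioc (-(2 : ℝ) ^ k) (2 ^ k)).indicator h (ξ, σ) := by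
        refine lintegral_mono fun ξ => lintegral_mono fun σ => ?_
        refine (mul_le_mul_right (weight_le_tsum hb0.le σ) _).trans (le_of_eq ?_)
        rw [← ENNReal.tsum_mul_left]
        refine tsum_congr fun k => ?_
        by_cases hσ : σ ∈ Set.Ioc (-(2 : ℝ) ^ k) (2 ^ k)
        · rw [Set.indicator_of_mem hσ, Set.indicator_of_mem (by simpa using hσ)]
          simp only [Pi.one_apply, hc]
          ring
        · rw [Set.indicator_of_notMem hσ, Set.indicator_of_notMem (by simpa using hσ)]
          simp
    _ = ∑' k : ℕ, c k * ∫⁻ ξ in Set.Ioc (-(n : ℝ)) n,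
        ∫⁻ σ in Set.Ioc (-(2 : ℝ) ^ k) (2 ^ k), h (ξ, σ) := by
        have : ∀ ξ, ∫⁻ σ, ∑' k : ℕ, c k *
            (Set.univ ×ˢ Set.Ioc (-(2 : ℝ) ^ k) (2 ^ k)).indicator h (ξ, σ) =
            ∑' k : ℕ, ∫⁻ σ, c k *
            (Set.univ ×ˢ Set.Ioc (-(2 : ℝ) ^ k) (2 ^ k)).indicator h (ξ, σ) := fun ξ =>
          lintegral_tsum fun k => ((hmk k).comp measurable_prodMk_left).aemeasurable
        simp_rw [this]
        rw [lintegral_tsum fun k => (hmk k).lintegral_prod_right'.aemeasurable]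
        refine tsum_congr fun k => ?_
        rw [← lintegral_const_mul' _ _ ENNReal.ofReal_ne_top]
        refine lintegral_congr fun ξ => ?_
        rw [lintegral_const_mul' _ _ ENNReal.ofReal_ne_top,
          ← lintegral_indicator measurableSet_Ioc]
        congr 1
        refine lintegral_congr fun σ => ?_
        by_cases hσ : σ ∈ Set.Ioc (-(2 : ℝ) ^ k) (2 ^ k)
        · rw [Set.indicator_of_mem hσ, Set.indicator_of_mem (by simpa using hσ)]
        · rw [Set.indicator_of_notMem hσ, Set.indicator_of_notMem (by simpa using hσ)]
    _ ≤ ∑' k : ℕ, ENNReal.ofReal (4 ^ b * C * r ^ k) * N := by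
        refine ENNReal.tsum_le_tsum fun k => ?_
        refine (mul_le_mul_right (hC G M n (2 ^ k) hG hM (Nat.cast_nonneg n) (by positivity))
          _).trans (le_of_eq ?_)
        rw [← mul_assoc, hc, ← ENNReal.ofReal_mul (by positivity)]
        congr 2
        rw [hr, ← Real.rpow_natCast (2 ^ (θ - 2 * b)) k, ← Real.rpow_mul zero_le_two,
          mul_comm (θ - 2 * b), Real.rpow_mul zero_le_two, Real.rpow_natCast, sub_eq_add_neg,
          Real.rpow_add (by positivity)]
        ring
    _ = ENNReal.ofReal (4 ^ b * C * (1 - r)⁻¹) * N := by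
        rw [ENNReal.tsum_mul_right, ← ENNReal.ofReal_tsum_of_nonneg (fun k => by positivity)
          ((summable_geometric_of_lt_one hr0.le hr1).mul_left _), tsum_mul_left,
          tsum_geometric_of_lt_one hr0.le hr1]

lemma SchwartzMap.exists_decay (F : SchwartzMap (ℝ × ℝ) ℂ) :
    ∃ M, ∀ x t, ‖F (x, t)‖ ≤ M * ((1 + x ^ 2)⁻¹ * (1 + t ^ 2)⁻¹) := by
  refine ⟨2 ^ 4 * ((Finset.Iic (4, 0)).sup fun m => SchwartzMap.seminorm ℝ m.1 m.2) F,
    fun x t => ?_⟩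
  have h := SchwartzMap.one_add_le_sup_seminorm_apply (𝕜 := ℝ) (m := (4, 0)) le_rfl le_rfl F (x, t)
  rw [norm_iteratedFDeriv_zero] at h
  rw [← mul_inv, ← div_eq_mul_inv, le_div_iff₀ (by positivity), mul_comm]
  refine le_trans ?_ h
  gcongr
  have hx : |x| ≤ ‖(x, t)‖ := norm_fst_le (x, t)
  have ht : |t| ≤ ‖(x, t)‖ := norm_snd_le (x, t)
  have hsq : ∀ y : ℝ, |y| ≤ ‖(x, t)‖ → 1 + y ^ 2 ≤ (1 + ‖(x, t)‖) ^ 2 := fun y hy => by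
    rw [← sq_abs]
    nlinarith [abs_nonneg y]
  calc (1 + x ^ 2) * (1 + t ^ 2) ≤ (1 + ‖(x, t)‖) ^ 2 * (1 + ‖(x, t)‖) ^ 2 := by
        gcongr
        exacts [hsq x hx, hsq t ht]
    _ = _ := by ring

lemma measurePreserving_toLp :
    MeasurePreserving (WithLp.toLp 2 : ℝ × ℝ → WithLp 2 (ℝ × ℝ)) :=
  WithLp.volume_preserving_toLp ℝ ℝ

lemma integral_withLp_prod (f : WithLp 2 (ℝ × ℝ) → ℂ) :
    ∫ v, f v = ∫ z : ℝ × ℝ, f (WithLp.toLp 2 z) :=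
  (measurePreserving_toLp.integral_comp
    (MeasurableEquiv.toLp 2 (ℝ × ℝ)).measurableEmbedding f).symm

open scoped FourierTransform in
lemma fourier_withLp_eq_FT2 {G : ℝ → ℝ → ℂ}
    (hG : Integrable (Function.uncurry G) (volume.prod volume)) (w : WithLp 2 (ℝ × ℝ)) :
    𝓕 (fun z : WithLp 2 (ℝ × ℝ) => G z.fst z.snd) w = FT2 G (2 * π * w.fst) (2 * π * w.snd) := by
  rw [Real.fourier_eq', integral_withLp_prod, FT2, Measure.volume_eq_prod, integral_prod]
  · refine integral_congr_ae (Filter.Eventually.of_forall fun x =>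
      integral_congr_ae (Filter.Eventually.of_forall fun t => ?_))
    simp only [smul_eq_mul, WithLp.prod_inner_apply]
    congr 2
    simp
    ring
  · refine hG.bdd_mul (c := 1) (f := fun z : ℝ × ℝ => Complex.exp
      (((-2 * π * inner ℝ (WithLp.toLp 2 z) w : ℝ) : ℂ) * Complex.I))
      (Continuous.aestronglyMeasurable (by
        simp only [WithLp.prod_inner_apply]
        simp
        fun_prop))
      (Filter.Eventually.of_forall fun z => ?_)
    rw [Complex.norm_exp_ofReal_mul_I]

open scoped FourierTransform in
/-- A Parseval inequality for a Schwartz function against an integrable one. -/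
lemma enorm_integral_mul_conj_le (F : SchwartzMap (ℝ × ℝ) ℂ) {G : ℝ → ℝ → ℂ}
    (hG : Integrable (Function.uncurry G) (volume.prod volume)) :
    ‖∫ z : ℝ × ℝ, F z * conj (G z.1 z.2)‖ₑ ≤
      ∫⁻ ξ, ∫⁻ τ, ‖FT2 (fun x t => F (x, t)) ξ τ‖ₑ * ‖FT2 G ξ τ‖ₑ := by
  set E := WithLp 2 (ℝ × ℝ)
  set F' : SchwartzMap E ℂ := SchwartzMap.compCLMOfContinuousLinearEquiv ℂ
    (WithLp.prodContinuousLinearEquiv 2 ℝ ℝ ℝ) F with hF'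
  set G' : E → ℂ := fun z => G z.fst z.snd with hG'
  have hF'c : (F' : E → ℂ) = fun z => F (z.fst, z.snd) := rfl
  have hG'i : Integrable G' := by
    rw [← (measurePreserving_toLp).integrable_comp_emb
      (MeasurableEquiv.toLp 2 (ℝ × ℝ)).measurableEmbedding]
    exact hG
  have key : ∫ ξ, inner ℂ (𝓕 G' ξ) (𝓕 F' ξ) = ∫ x, inner ℂ (G' x) (F' x) := by
    have h := VectorFourier.integral_sesq_fourierIntegral_eq_neg_flip (innerSL ℂ (E := ℂ))
      (L := innerₗ E) continuous_fourierChar continuous_inner hG'i (𝓕 F').integrable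
      (μ := volume) (ν := volume)
    have h2 : 𝓕⁻ (𝓕 F') = F' := FourierTransform.fourierInv_fourier_eq F'
    have h3 : 𝓕⁻ (⇑(𝓕 F' : SchwartzMap E ℂ)) = F' := by rw [← SchwartzMap.fourierInv_coe, h2]
    have h4 : VectorFourier.fourierIntegral 𝐞 volume (-(innerₗ E).flip)
        (⇑(𝓕 F' : SchwartzMap E ℂ)) = F' := by
      rw [← h3]
      ext x
      simp [Real.fourierInv_eq, VectorFourier.fourierIntegral]
    rw [h4] at h
    simpa using! h
  have hl : ∫ z : ℝ × ℝ, F z * conj (G z.1 z.2) = ∫ ξ, inner ℂ (𝓕 G' ξ) (𝓕 F' ξ) := by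
    rw [key, integral_withLp_prod]
    simp [hF'c, hG']
  have hFi : Integrable (Function.uncurry fun x t => F (x, t)) (volume.prod volume) := F.integrable
  rw [hl]
  set H : ℝ → ℝ → ℝ≥0∞ := fun ξ τ => ‖FT2 (fun x t => F (x, t)) ξ τ‖ₑ * ‖FT2 G ξ τ‖ₑ with hH
  have hpt : ∀ w : E, ‖inner ℂ (𝓕 G' w) (𝓕 F' w)‖ₑ ≤ H (2 * π * w.fst) (2 * π * w.snd) := by
    intro w
    rw [SchwartzMap.fourier_coe, hF'c, hG', fourier_withLp_eq_FT2 hG,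
      fourier_withLp_eq_FT2 hFi]
    simp [hH, enorm_mul, mul_comm]
  calc _ ≤ ∫⁻ w : E, H (2 * π * w.fst) (2 * π * w.snd) :=
        (enorm_integral_le_lintegral_enorm _).trans (lintegral_mono hpt)
    _ = ∫⁻ z : ℝ × ℝ, H (2 * π * z.1) (2 * π * z.2) :=
        (measurePreserving_toLp.lintegral_comp_emb
          (MeasurableEquiv.toLp 2 (ℝ × ℝ)).measurableEmbedding _).symm
    _ ≤ ∫⁻ x, ∫⁻ t, H (2 * π * x) (2 * π * t) := lintegral_prod_le _
    _ = ENNReal.ofReal (2 * π)⁻¹ * (ENNReal.ofReal (2 * π)⁻¹ * ∫⁻ ξ, ∫⁻ τ, H ξ τ) := by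
        simp_rw [lintegral_comp_const_mul (2 * π) (by positivity),
          lintegral_const_mul' _ _ ENNReal.ofReal_ne_top]
        rw [lintegral_comp_const_mul (f := fun ξ => ∫⁻ τ, H ξ τ) (2 * π) (by positivity)]
    _ ≤ 1 * (1 * ∫⁻ ξ, ∫⁻ τ, H ξ τ) := by
        have : ENNReal.ofReal (2 * π)⁻¹ ≤ 1 := by
          rw [ENNReal.ofReal_le_one]
          exact inv_le_one_of_one_le₀ (by nlinarith [pi_gt_three])
        gcongr
    _ = _ := by simp [hH]

lemma measurable_FT2 {G : ℝ → ℝ → ℂ} (hG : Continuous (Function.uncurry G)) {M : ℝ}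
    (hM : ∀ x t, ‖G x t‖ ≤ M * ((1 + x ^ 2)⁻¹ * (1 + t ^ 2)⁻¹)) :
    Measurable fun z : ℝ × ℝ => FT2 G z.1 z.2 := by
  simpa [phase] using measurable_FT2_shift 0 0 hG hM

/-- Cauchy–Schwarz for the pairing of `X_{0,b}` and `X_{0,-b}`. -/
lemma lintegral_mul_le_XNorm_mul (ν μ b : ℝ) {F G : ℝ → ℝ → ℂ}
    (hF : Measurable fun z : ℝ × ℝ => FT2 F z.1 z.2)
    (hG : Measurable fun z : ℝ × ℝ => FT2 G z.1 z.2) :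
    ∫⁻ ξ, ∫⁻ τ, ‖FT2 F ξ τ‖ₑ * ‖FT2 G ξ τ‖ₑ ≤ XNorm ν μ 0 b F *
      (∫⁻ ξ, ∫⁻ τ, ‖FT2 G ξ τ‖ₑ ^ 2 *
        ENNReal.ofReal ((1 + (τ - phase ν μ ξ) ^ 2) ^ (-b))) ^ (1 / 2 : ℝ) := by
  have hph := (continuous_phase ν μ).measurable
  have hw : ∀ c : ℝ, Measurable fun z : ℝ × ℝ =>
      ENNReal.ofReal ((1 + (z.2 - phase ν μ z.1) ^ 2) ^ c) := fun c => by
    have : Measurable fun z : ℝ × ℝ => phase ν μ z.1 := hph.comp measurable_fst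
    fun_prop
  set f : ℝ × ℝ → ℝ≥0∞ := fun z =>
    ‖FT2 F z.1 z.2‖ₑ * ENNReal.ofReal ((1 + (z.2 - phase ν μ z.1) ^ 2) ^ (b / 2)) with hf
  set g : ℝ × ℝ → ℝ≥0∞ := fun z =>
    ‖FT2 G z.1 z.2‖ₑ * ENNReal.ofReal ((1 + (z.2 - phase ν μ z.1) ^ 2) ^ (-b / 2)) with hg
  have hfm : Measurable f := hF.enorm.mul (hw _)
  have hgm : Measurable g := hG.enorm.mul (hw _)
  have hpos : ∀ z : ℝ × ℝ, 0 < 1 + (z.2 - phase ν μ z.1) ^ 2 := fun z => by positivity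
  have hsq : ∀ (z : ℝ × ℝ) (c : ℝ), ENNReal.ofReal ((1 + (z.2 - phase ν μ z.1) ^ 2) ^ (c / 2)) ^ 2 =
      ENNReal.ofReal ((1 + (z.2 - phase ν μ z.1) ^ 2) ^ c) := fun z c => by
    rw [← ENNReal.ofReal_pow (Real.rpow_nonneg (hpos z).le _), ← Real.rpow_natCast,
      ← Real.rpow_mul (hpos z).le]
    congr 2
    push_cast
    ring
  have e0 : ∫⁻ ξ, ∫⁻ τ, ‖FT2 F ξ τ‖ₑ * ‖FT2 G ξ τ‖ₑ = ∫⁻ z, (f * g) z ∂(volume.prod volume) := by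
    rw [lintegral_prod _ (hfm.mul hgm).aemeasurable]
    refine lintegral_congr fun ξ => lintegral_congr fun τ => ?_
    have : ENNReal.ofReal ((1 + (τ - phase ν μ ξ) ^ 2) ^ (b / 2)) *
        ENNReal.ofReal ((1 + (τ - phase ν μ ξ) ^ 2) ^ (-b / 2)) = 1 := by
      rw [← ENNReal.ofReal_mul (Real.rpow_nonneg (hpos (ξ, τ)).le _),
        ← Real.rpow_add (hpos (ξ, τ)), show b / 2 + -b / 2 = 0 by ring]
      simp
    simp only [Pi.mul_apply, hf, hg]
    rw [mul_mul_mul_comm, this, mul_one]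
  have e1 : (∫⁻ z, f z ^ (2 : ℝ) ∂(volume.prod volume)) ^ (1 / 2 : ℝ) = XNorm ν μ 0 b F := by
    rw [XNorm, lintegral_prod _ (hfm.pow_const _).aemeasurable]
    congr 1
    refine lintegral_congr fun ξ => lintegral_congr fun τ => ?_
    simp only [hf, ENNReal.rpow_two, mul_pow, Real.rpow_zero, one_mul]
    rw [hsq (ξ, τ) b, mul_comm]
    rfl
  have e2 : ∫⁻ z, g z ^ (2 : ℝ) ∂(volume.prod volume) = ∫⁻ ξ, ∫⁻ τ, ‖FT2 G ξ τ‖ₑ ^ 2 *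
      ENNReal.ofReal ((1 + (τ - phase ν μ ξ) ^ 2) ^ (-b)) := by
    rw [lintegral_prod _ (hgm.pow_const _).aemeasurable]
    refine lintegral_congr fun ξ => lintegral_congr fun τ => ?_
    simp only [hg, ENNReal.rpow_two, mul_pow]
    rw [hsq (ξ, τ) (-b)]
  rw [e0, ← e1, ← e2]
  exact ENNReal.lintegral_mul_le_Lp_mul_Lq _ Real.HolderConjugate.two_two hfm.aemeasurable
    hgm.aemeasurable

lemma ofReal_integral_norm_rpow_schwartz (F : SchwartzMap (ℝ × ℝ) ℂ) {q : ℝ} (hq : 0 < q) :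
    Integrable (fun z => ‖F z‖ ^ q) ∧
      ENNReal.ofReal (∫ z, ‖F z‖ ^ q) = ∫⁻ z, ‖F z‖ₑ ^ q := by
  have hint : Integrable fun z => ‖F z‖ ^ q := by
    have := (F.memLp (ENNReal.ofReal q) (volume : Measure (ℝ × ℝ))).integrable_norm_rpow
      (by simpa using hq) ENNReal.ofReal_ne_top
    rwa [ENNReal.toReal_ofReal hq.le] at this
  refine ⟨hint, ?_⟩
  rw [ofReal_integral_eq_lintegral_ofReal hint
    (Filter.Eventually.of_forall fun z => by positivity)]
  refine lintegral_congr fun z => ?_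
  rw [← ENNReal.ofReal_rpow_of_nonneg (norm_nonneg _) hq.le, ofReal_norm]

/-- The function `|F|^{q-2} F`, which is dual to `F` in the `L^q`-`L^{q'}` pairing. -/
def dualFn (q : ℝ) (F : SchwartzMap (ℝ × ℝ) ℂ) (x t : ℝ) : ℂ :=
  ((‖F (x, t)‖ ^ (q - 2) : ℝ) : ℂ) * F (x, t)

lemma continuous_dualFn {q : ℝ} (hq : 2 ≤ q) (F : SchwartzMap (ℝ × ℝ) ℂ) :
    Continuous (Function.uncurry (dualFn q F)) := by
  have hF := F.continuous
  have : Continuous fun z : ℝ × ℝ => ‖F z‖ ^ (q - 2) :=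
    hF.norm.rpow_const fun _ => Or.inr (by linarith)
  simp only [dualFn, Function.uncurry_def, Prod.mk.eta]
  fun_prop

lemma dualFn_decay {q : ℝ} (hq : 2 ≤ q) (F : SchwartzMap (ℝ × ℝ) ℂ) :
    ∃ M, ∀ x t, ‖dualFn q F x t‖ ≤ M * ((1 + x ^ 2)⁻¹ * (1 + t ^ 2)⁻¹) := by
  obtain ⟨M, hM⟩ := F.exists_decay
  have hM0 := decay_const_nonneg (G := fun x t => F (x, t)) hM
  refine ⟨M ^ (q - 2) * M, fun x t => ?_⟩
  have hFM : ‖F (x, t)‖ ≤ M := by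
    refine (hM x t).trans (mul_le_of_le_one_right hM0 (mul_le_one₀ ?_ (by positivity) ?_)) <;>
    · refine inv_le_one_of_one_le₀ ?_
      nlinarith [sq_nonneg x, sq_nonneg t]
  rw [dualFn, norm_mul, Complex.norm_real, Real.norm_of_nonneg (by positivity), mul_assoc]
  gcongr
  exact hM x t

lemma enorm_dualFn_rpow {q : ℝ} (hq : 2 ≤ q) (F : SchwartzMap (ℝ × ℝ) ℂ) (x t : ℝ) :
    ‖dualFn q F x t‖ₑ ^ (q / (q - 1)) = ‖F (x, t)‖ₑ ^ q := by
  have hq1 : 0 < q - 1 := by linarith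
  have h : ‖dualFn q F x t‖ = ‖F (x, t)‖ ^ (q - 1) := by
    rw [dualFn, norm_mul, Complex.norm_real, Real.norm_of_nonneg (by positivity),
      show q - 1 = (q - 2) + 1 by ring, Real.rpow_add_of_nonneg (norm_nonneg _) (by linarith)
      zero_le_one, Real.rpow_one]
  rw [← ofReal_norm, h, ← ENNReal.ofReal_rpow_of_nonneg (norm_nonneg _) hq1.le, ofReal_norm,
    ← ENNReal.rpow_mul, mul_div_cancel₀ _ hq1.ne']

lemma lintegral_enorm_rpow_le_dualFn {q : ℝ} (hq : 2 ≤ q) (F : SchwartzMap (ℝ × ℝ) ℂ) :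
    ∫⁻ z, ‖F z‖ₑ ^ q ≤
      ∫⁻ ξ, ∫⁻ τ, ‖FT2 (fun x t => F (x, t)) ξ τ‖ₑ * ‖FT2 (dualFn q F) ξ τ‖ₑ := by
  obtain ⟨M, hM⟩ := dualFn_decay hq F
  refine le_trans (le_of_eq ?_)
    (enorm_integral_mul_conj_le F (integrable_prod_of_decay (continuous_dualFn hq F) hM))
  have e : ∀ z : ℝ × ℝ, F z * conj (dualFn q F z.1 z.2) = ((‖F z‖ ^ q : ℝ) : ℂ) := fun z => by
    have h2 : ‖F z‖ ^ q = ‖F z‖ ^ (q - 2) * ‖F z‖ ^ 2 := by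
      rw [← Real.rpow_two, ← Real.rpow_add_of_nonneg (norm_nonneg _) (by linarith) zero_le_two]
      congr 1
      ring
    simp only [dualFn, Prod.mk.eta, map_mul, Complex.conj_ofReal]
    rw [mul_left_comm, Complex.mul_conj', h2]
    push_cast
    ring
  simp_rw [e]
  rw [integral_complex_ofReal, ← (ofReal_integral_norm_rpow_schwartz F (by linarith)).2, ← ofReal_norm]
  congr 1
  rw [Complex.norm_real, Real.norm_of_nonneg (integral_nonneg fun z => by positivity)]

lemma lintegral_enorm_sq_le_XNorm (ν μ : ℝ) {b : ℝ} (hb : 0 ≤ b) (F : SchwartzMap (ℝ × ℝ) ℂ) :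
    (∫⁻ z, ‖F z‖ₑ ^ (2 : ℝ)) ^ (1 / 2 : ℝ) ≤ XNorm ν μ 0 b fun x t => F (x, t) := by
  rw [XNorm]
  gcongr
  refine (lintegral_enorm_rpow_le_dualFn le_rfl F).trans
    (lintegral_mono fun ξ => lintegral_mono fun τ => ?_)
  have : dualFn 2 F = fun x t => F (x, t) := by
    ext x t
    simp [dualFn]
  rw [this]
  change _ ≤ _ * ‖FT2 (fun x t => F (x, t)) ξ τ‖ₑ ^ 2
  rw [← sq]
  refine le_mul_of_one_le_left zero_le ?_
  rw [Real.rpow_zero, one_mul, ENNReal.one_le_ofReal]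
  exact Real.one_le_rpow (by nlinarith [sq_nonneg (τ - phase ν μ ξ)]) hb

lemma rpow_inv_le_of_le_mul {q : ℝ} (hq : 2 < q) {I X C : ℝ≥0∞} (hI : I ≠ ∞)
    (h : I ≤ X * (C * I ^ (2 - 2 / q)) ^ (1 / 2 : ℝ)) :
    I ^ (1 / q) ≤ C ^ (1 / 2 : ℝ) * X := by
  have hq0 : 0 < q := by linarith
  rcases eq_or_ne I 0 with rfl | hI0
  · simp [hq0]
  · rw [ENNReal.mul_rpow_of_nonneg _ _ (by norm_num), ← ENNReal.rpow_mul,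
      show (2 - 2 / q) * (1 / 2) = 1 - 1 / q by ring] at h
    have h2 : I = I ^ (1 / q) * I ^ (1 - 1 / q) := by
      rw [← ENNReal.rpow_add _ _ hI0 hI]
      simp
    have h3 : I ^ (1 - 1 / q) ≠ 0 := (ENNReal.rpow_pos (pos_iff_ne_zero.2 hI0) hI).ne'
    have h4 : I ^ (1 - 1 / q) ≠ ∞ := by
      simp [ENNReal.rpow_eq_top_iff, hI, hI0]
    refine (ENNReal.mul_le_mul_iff_left h3 h4).1 ?_
    rw [← h2]
    refine h.trans (le_of_eq ?_)
    ring

/-- **Lemma 2.4** (space-time `L^q` embedding of Bourgain spaces): for every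
`q ∈ [2,8]` and `b > 2(q-2)/(3q)` there is `C > 0`, depending only on `ν, μ, q, b`,
such that `‖F‖_{L^q_{xt}(ℝ²)} ≤ C ‖F‖_{X_{0,b}}` for every Schwartz `F` on `ℝ²`. -/
theorem benjamin_bourgain_Lq_embedding (ν μ : ℝ) (hμ : μ ≠ 0)
    (q : ℝ) (hq : q ∈ Set.Icc (2 : ℝ) 8) (b : ℝ) (hb : 2 * (q - 2) / (3 * q) < b) :
    ∃ C > (0 : ℝ), ∀ F : SchwartzMap (ℝ × ℝ) ℂ,
      eLpNorm (fun z : ℝ × ℝ => F z) (ENNReal.ofReal q) (volume : Measure (ℝ × ℝ)) ≤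
        ENNReal.ofReal C * XNorm ν μ 0 b (fun x t => F (x, t)) := by
  obtain ⟨hq2, hq8⟩ := hq
  have hq0 : 0 < q := by linarith
  have hnorm : ∀ F : SchwartzMap (ℝ × ℝ) ℂ,
      eLpNorm (fun z : ℝ × ℝ => F z) (ENNReal.ofReal q) (volume : Measure (ℝ × ℝ)) =
        (∫⁻ z, ‖F z‖ₑ ^ q) ^ (1 / q) := fun F => by
    rw [eLpNorm_eq_lintegral_rpow_enorm_toReal (by simpa using hq0) ENNReal.ofReal_ne_top,
      ENNReal.toReal_ofReal hq0.le]
  simp_rw [hnorm]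
  rcases hq2.eq_or_lt with rfl | hq2
  · refine ⟨1, one_pos, fun F => ?_⟩
    rw [ENNReal.ofReal_one, one_mul]
    exact lintegral_enorm_sq_le_XNorm ν μ (by norm_num at hb; exact hb.le) F
  · obtain ⟨C, hC0, hC⟩ := lintegral_FT2_weighted_le ν hμ hq2 hq8 hb
    refine ⟨C ^ (1 / 2 : ℝ), by positivity, fun F => ?_⟩
    obtain ⟨M, hM⟩ := F.exists_decay
    obtain ⟨M', hM'⟩ := dualFn_decay hq2.le F
    have hF : Continuous (Function.uncurry fun x t => F (x, t)) := F.continuous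
    have hG := continuous_dualFn hq2.le F
    have hI : ∫⁻ z, ‖F z‖ₑ ^ q ≠ ∞ := by
      rw [← (ofReal_integral_norm_rpow_schwartz F hq0).2]
      exact ENNReal.ofReal_ne_top
    have hsw : ∫⁻ t, ∫⁻ x, ‖dualFn q F x t‖ₑ ^ (q / (q - 1)) = ∫⁻ z, ‖F z‖ₑ ^ q := by
      simp_rw [enorm_dualFn_rpow hq2.le]
      rw [Measure.volume_eq_prod, lintegral_prod_symm]
      exact (F.continuous.measurable.enorm.pow_const _).aemeasurable
    rw [← ENNReal.ofReal_rpow_of_nonneg hC0.le (by norm_num)]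
    refine rpow_inv_le_of_le_mul hq2 hI ?_
    refine (lintegral_enorm_rpow_le_dualFn hq2.le F).trans
      ((lintegral_mul_le_XNorm_mul ν μ b (measurable_FT2 hF hM)
        (measurable_FT2 hG hM')).trans ?_)
    gcongr
    rw [← hsw]
    exact hC _ M' hG hM'
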